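/- arXiv:0807.2073 — 6 statements merged into one kernel-verified Lean document; each statement's English description precedes it below -/
import Mathlib

section
/- For every integer h ≥ 2 and for every function f : ℤ → ℕ₀ ∪ {∞} such that f⁻¹(0) is finite, there exists a set A ⊆ ℤ such that f(n) = r_{A,h}(n) for all integers n, where r_{A,h} is the unordered representation function of order h of A. -/
/-- The unordered representation function of order `h` of a set `A ⊆ ℤ`: the number
(in `ℕ∞`) of nondecreasing `h`-tuples of elements of `A` with sum `n`. -/
noncomputable def unorderedRep (A : Set ℤ) (h : ℕ) (n : ℤ) : ℕ∞ :=
  {t : Fin h → ℤ | (∀ i, t i ∈ A) ∧ Monotone t ∧ ∑ i, t i = n}.encard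

/-- Multiset representations of `n` as a sum of `h` elements of `A`. -/
def MRep (A : Set ℤ) (h : ℕ) (n : ℤ) : Set (Multiset ℤ) :=
  {M | (∀ x ∈ M, x ∈ A) ∧ M.card = h ∧ M.sum = n}

theorem MRep_mono {A A' : Set ℤ} (hA : A ⊆ A') (h : ℕ) (n : ℤ) : MRep A h n ⊆ MRep A' h n :=
  fun _ hM => ⟨fun x hx => hA (hM.1 x hx), hM.2⟩

theorem unorderedRep_eq (A : Set ℤ) (h : ℕ) (n : ℤ) :
    unorderedRep A h n = (MRep A h n).encard := by
  unfold unorderedRep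
  have himg : (fun t : Fin h → ℤ => (List.ofFn t : Multiset ℤ)) ''
      {t : Fin h → ℤ | (∀ i, t i ∈ A) ∧ Monotone t ∧ ∑ i, t i = n} = MRep A h n := by
    ext M
    constructor
    · rintro ⟨t, ⟨h1, h2, h3⟩, rfl⟩
      refine ⟨?_, by simp, by simp [List.sum_ofFn, h3]⟩
      intro x hx
      simp only [Multiset.mem_coe, List.mem_ofFn] at hx
      obtain ⟨i, rfl⟩ := hx
      exact h1 i
    · rintro ⟨h1, h2, h3⟩
      subst h2
      have hl : (M.sort (· ≤ ·)).length = M.card := Multiset.length_sort _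
      have hof : List.ofFn (fun i : Fin M.card => (M.sort (· ≤ ·))[i.1]'(by rw [hl]; exact i.2))
          = M.sort (· ≤ ·) := by
        apply List.ext_getElem
        · simp
        · intro i _ _
          simp
      have hc : ((List.ofFn (fun i : Fin M.card =>
          (M.sort (· ≤ ·))[i.1]'(by rw [hl]; exact i.2)) : List ℤ) : Multiset ℤ) = M := by
        rw [hof]; exact Multiset.sort_eq _ _
      refine ⟨fun i => (M.sort (· ≤ ·))[i.1]'(by rw [hl]; exact i.2), ⟨?_, ?_, ?_⟩, hc⟩
      · intro i
        apply h1
        rw [← Multiset.mem_sort (r := (· ≤ ·))]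
        exact List.getElem_mem _
      · intro i j hij
        have hs := Multiset.pairwise_sort M (· ≤ ·)
        rcases eq_or_lt_of_le hij with rfl | hlt
        · exact le_rfl
        · exact List.pairwise_iff_getElem.1 hs i.1 j.1 _ _ hlt
      · rw [← List.sum_ofFn, ← Multiset.sum_coe, hc, h3]
  rw [← himg, Set.InjOn.encard_image]
  intro t ht t' ht' heq
  have hp : (List.ofFn t).Perm (List.ofFn t') := Multiset.coe_eq_coe.1 heq
  have e : List.ofFn t = List.ofFn t' := by
    apply hp.eq_of_pairwise (le := (· ≤ ·))
    · intro a b _ _ h1 h2; exact le_antisymm h1 h2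
    · rw [List.pairwise_ofFn]; intro i j hij; exact ht.2.1 hij.le
    · rw [List.pairwise_ofFn]; intro i j hij; exact ht'.2.1 hij.le
  exact List.ofFn_injective e

theorem decomp (A : Set ℤ) (b c : ℤ) (M : Multiset ℤ) :
    (∀ x ∈ M, x ∈ insert b (insert c A)) → ∃ (S : Multiset ℤ) (i j : ℕ), (∀ x ∈ S, x ∈ A) ∧
      M = S + Multiset.replicate i b + Multiset.replicate j c := by
  induction M using Multiset.induction_on with
  | empty => exact fun _ => ⟨0, 0, 0, by simp, by simp⟩
  | cons a M ih =>
    intro hM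
    obtain ⟨S, i, j, hS, rfl⟩ := ih (fun x hx => hM x (Multiset.mem_cons_of_mem hx))
    have ha := hM a (Multiset.mem_cons_self _ _)
    rcases ha with rfl | rfl | ha
    · refine ⟨S, i + 1, j, hS, ?_⟩
      rw [Multiset.replicate_succ]; simp
    · refine ⟨S, i, j + 1, hS, ?_⟩
      rw [Multiset.replicate_succ]; simp
    · refine ⟨a ::ₘ S, i, j, ?_, by simp⟩
      intro x hx
      rcases Multiset.mem_cons.1 hx with rfl | hx
      · exact ha
      · exact hS x hx

theorem abs_sum_bound (B : ℤ) (S : Multiset ℤ) :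
    (∀ x ∈ S, |x| ≤ B) → |S.sum| ≤ S.card * B := by
  induction S using Multiset.induction_on with
  | empty => simp
  | cons a S ih =>
    intro hS
    have h1 := ih (fun x hx => hS x (Multiset.mem_cons_of_mem hx))
    have h2 := hS a (Multiset.mem_cons_self _ _)
    have h3 := abs_add_le a S.sum
    simp only [Multiset.sum_cons, Multiset.card_cons]
    push_cast
    linarith

theorem arith_aux (h i j i' d : ℕ) (hh : 2 ≤ h) (h2 : i' + (j + d) ≤ h)
    (e : (i : ℤ) - j * (h - 1) = i' - (j + d) * (h - 1)) :
    d = 0 ∧ i = i' ∨ d = 1 ∧ i = 0 ∧ j = 0 ∧ i' = h - 1 := by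
  have hi : (i' : ℤ) = i + d * (h - 1) := by linarith
  have h2' : (i' : ℤ) + (j + d) ≤ h := by exact_mod_cast h2
  rcases d with _ | _ | d
  · left; simp at hi; omega
  · right; clear e; push_cast at hi h2'; exact ⟨rfl, by omega, by omega, by omega⟩
  · exfalso
    push_cast at *
    have : (0:ℤ) ≤ d * h := by positivity
    nlinarith

theorem arith (h i j i' j' : ℕ) (hh : 2 ≤ h) (h1 : i + j ≤ h) (h2 : i' + j' ≤ h)
    (e : (i : ℤ) - j * (h - 1) = i' - j' * (h - 1)) :
    (i = i' ∧ j = j') ∨ (i = 0 ∧ j = 0 ∧ i' = h - 1 ∧ j' = 1) ∨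
      (i' = 0 ∧ j' = 0 ∧ i = h - 1 ∧ j = 1) := by
  rcases le_total j j' with hj | hj
  · obtain ⟨d, rfl⟩ := Nat.exists_eq_add_of_le hj
    push_cast at e
    have := arith_aux h i j i' d hh h2 e
    omega
  · obtain ⟨d, rfl⟩ := Nat.exists_eq_add_of_le hj
    push_cast at e
    have := arith_aux h i' j' i d hh h1 e.symm
    omega

/-- Invariant of the construction. -/
def GoodSet (h : ℕ) (f : ℤ → ℕ∞) (A : Set ℤ) : Prop :=
  A.Finite ∧ (∀ n, (MRep A h n).encard ≤ f n) ∧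
    ∀ M M' : Multiset ℤ, (∀ x ∈ M, x ∈ A) → (∀ x ∈ M', x ∈ A) → M.card = M'.card →
      M.card < h → M.sum = M'.sum → M = M'

theorem finite_bound (A : Set ℤ) (hA : A.Finite) : ∃ B : ℤ, ∀ x ∈ A, |x| ≤ B := by
  obtain ⟨B, hB⟩ := (hA.image (fun x => |x|)).bddAbove
  exact ⟨B, fun x hx => hB ⟨x, hx, rfl⟩⟩

theorem step (h : ℕ) (hh : 2 ≤ h) (f : ℤ → ℕ∞) (hf : {n : ℤ | f n = 0}.Finite)
    (A : Set ℤ) (hA : GoodSet h f A) (n : ℤ) (hn : (MRep A h n).encard < f n) :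
    ∃ A' : Set ℤ, A ⊆ A' ∧ GoodSet h f A' ∧
      (MRep A h n).encard + 1 ≤ (MRep A' h n).encard := by
  obtain ⟨hfin, hle, hsid⟩ := hA
  obtain ⟨B0, hB0⟩ := finite_bound _ ((hfin.union hf).union (Set.finite_singleton n))
  obtain ⟨B, hB1, hBB⟩ : ∃ B : ℤ, 1 ≤ B ∧ B0 ≤ B := ⟨max 1 B0, le_max_left _ _, le_max_right _ _⟩
  have hBA : ∀ x ∈ A, |x| ≤ B := fun x hx => (hB0 x (Or.inl (Or.inl hx))).trans hBB
  have hBf : ∀ x, f x = 0 → |x| ≤ B := fun x hx => (hB0 x (Or.inl (Or.inr hx))).trans hBB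
  have hBn : |n| ≤ B := (hB0 n (Or.inr rfl)).trans hBB
  have hhz : (2 : ℤ) ≤ h := by exact_mod_cast hh
  obtain ⟨b, hb⟩ : ∃ b : ℤ, b = 2 * (h * B) + 1 := ⟨_, rfl⟩
  obtain ⟨c, hc⟩ : ∃ c : ℤ, c = n - (h - 1) * b := ⟨_, rfl⟩
  have hhB : 2 * B ≤ h * B := by nlinarith
  have hbpos : 0 < b := by linarith
  have hbA : b ∉ A := by
    intro hx
    have := (le_abs_self b).trans (hBA b hx)
    linarith
  -- the sum formula
  have key : ∀ (S : Multiset ℤ) (i j : ℕ), (∀ x ∈ S, x ∈ A) → S.card + i + j ≤ h →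
      ∃ s : ℤ, |s| ≤ h * B ∧ s = S.sum + j * n ∧
      (S + Multiset.replicate i b + Multiset.replicate j c).sum
        = ((i : ℤ) - j * (h - 1)) * b + s := by
    intro S i j hS hcard
    refine ⟨S.sum + j * n, ?_, rfl, ?_⟩
    · have h1 := abs_sum_bound B S (fun x hx => hBA x (hS x hx))
      have h2 := abs_add_le S.sum (j * n)
      have h3 : |(j : ℤ) * n| ≤ j * B := by
        rw [abs_mul, Nat.abs_cast]
        exact mul_le_mul_of_nonneg_left hBn (by positivity)
      have h4 : ((S.card : ℤ) + j) * B ≤ h * B := by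
        apply mul_le_mul_of_nonneg_right _ (by linarith)
        exact_mod_cast (by omega : S.card + j ≤ h)
      linarith
    · simp only [Multiset.sum_add, Multiset.sum_replicate, nsmul_eq_mul, hc]
      ring
  have small : ∀ e s e' s' : ℤ, |s| ≤ h * B → |s'| ≤ h * B → e * b + s = e' * b + s' → e = e' := by
    intro e s e' s' h1 h2 h3
    rw [abs_le] at h1 h2
    by_contra hne
    rcases lt_or_gt_of_ne hne with hlt | hlt
    · nlinarith [mul_le_mul_of_nonneg_right (by linarith : e + 1 ≤ e') hbpos.le]
    · nlinarith [mul_le_mul_of_nonneg_right (by linarith : e' + 1 ≤ e) hbpos.le]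
  have big : ∀ e s : ℤ, |s| ≤ h * B → |e * b + s| ≤ B → e = 0 := by
    intro e s h1 h2
    apply small e s 0 (e * b + s) h1 (by linarith) (by ring)
  have hsid' : ∀ (S S' : Multiset ℤ) (i j : ℕ), (∀ x ∈ S, x ∈ A) → (∀ x ∈ S', x ∈ A) →
      S.card = S'.card → S.card < h →
      (S + Multiset.replicate i b + Multiset.replicate j c).sum =
      (S' + Multiset.replicate i b + Multiset.replicate j c).sum → S = S' := by
    intro S S' i j hS hS' hcard hlt hsum
    apply hsid S S' hS hS' hcard hlt
    simpa only [Multiset.sum_add, add_left_inj] using hsum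
  -- the new representation
  have hM0 : Multiset.replicate (h - 1) b + Multiset.replicate 1 c ∈
      MRep (insert b (insert c A)) h n := by
    refine ⟨?_, ?_, ?_⟩
    · intro x hx
      rw [Multiset.mem_add] at hx
      rcases hx with hx | hx
      · left; exact Multiset.eq_of_mem_replicate hx
      · right; left; exact Multiset.eq_of_mem_replicate hx
    · simp; omega
    · simp only [Multiset.sum_add, Multiset.sum_replicate, nsmul_eq_mul, hc]
      rw [Nat.cast_sub (by omega)]
      push_cast; ring
  have hM0' : Multiset.replicate (h - 1) b + Multiset.replicate 1 c ∉ MRep A h n := by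
    intro hx
    apply hbA
    apply hx.1
    rw [Multiset.mem_add]
    left
    rw [Multiset.mem_replicate]
    exact ⟨by omega, rfl⟩
  have hsub : A ⊆ insert b (insert c A) := fun x hx => Or.inr (Or.inr hx)
  -- coefficient zero
  have ezero : ∀ (S : Multiset ℤ) (i j : ℕ) (m : ℤ), (∀ x ∈ S, x ∈ A) →
      S + Multiset.replicate i b + Multiset.replicate j c ∈ MRep (insert b (insert c A)) h m →
      (i : ℤ) - j * (h - 1) = 0 →
      S + Multiset.replicate i b + Multiset.replicate j c ∈ MRep A h m ∨
      (m = n ∧ S + Multiset.replicate i b + Multiset.replicate j c =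
        Multiset.replicate (h - 1) b + Multiset.replicate 1 c) := by
    intro S i j m hS hM he
    have hcard := hM.2.1
    simp only [Multiset.card_add, Multiset.card_replicate] at hcard
    rcases arith h i j 0 0 hh (by omega) (by omega) (by simpa using he) with ⟨rfl, rfl⟩ | h1 | h1
    · left
      refine ⟨?_, hM.2⟩
      simpa using hS
    · omega
    · right
      obtain ⟨-, -, rfl, rfl⟩ := h1
      have : S = 0 := by rw [← Multiset.card_eq_zero]; omega
      subst this
      rw [zero_add] at hM ⊢
      exact ⟨hM.2.2.symm.trans hM0.2.2, rfl⟩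
  refine ⟨insert b (insert c A), hsub, ⟨(hfin.insert c).insert b, ?_, ?_⟩, ?_⟩
  · intro m
    by_cases hall : ∀ (S : Multiset ℤ) (i j : ℕ), (∀ x ∈ S, x ∈ A) →
      S + Multiset.replicate i b + Multiset.replicate j c ∈ MRep (insert b (insert c A)) h m →
      (i : ℤ) - j * (h - 1) = 0
    · by_cases hmn : m = n
      · subst hmn
        have : MRep (insert b (insert c A)) h m ⊆
            insert (Multiset.replicate (h - 1) b + Multiset.replicate 1 c) (MRep A h m) := by
          intro M hM
          obtain ⟨S, i, j, hS, rfl⟩ := decomp A b c M hM.1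
          rcases ezero S i j m hS hM (hall S i j hS hM) with h1 | h1
          · exact Or.inr h1
          · exact Or.inl h1.2
        refine (Set.encard_le_encard this).trans ((Set.encard_insert_le _ _).trans ?_)
        exact Order.add_one_le_of_lt hn
      · refine (Set.encard_le_encard ?_).trans (hle m)
        intro M hM
        obtain ⟨S, i, j, hS, rfl⟩ := decomp A b c M hM.1
        rcases ezero S i j m hS hM (hall S i j hS hM) with h1 | h1
        · exact h1
        · exact absurd h1.1 hmn
    · push Not at hall
      obtain ⟨S, i, j, hS, hM, he⟩ := hall
      have hcard := hM.2.1
      simp only [Multiset.card_add, Multiset.card_replicate] at hcard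
      obtain ⟨s, hs, -, hsum⟩ := key S i j hS (by omega)
      have hfm : f m ≠ 0 := by
        intro h0
        have h1 := hBf m h0
        rw [← hM.2.2, hsum] at h1
        exact he (big _ _ hs h1)
      refine le_trans ?_ (Order.one_le_iff_pos.2 (pos_iff_ne_zero.2 hfm))
      rw [Set.encard_le_one_iff]
      suffices hs : ∀ M' ∈ MRep (insert b (insert c A)) h m,
          M' = S + Multiset.replicate i b + Multiset.replicate j c by
        intro x y hx hy
        rw [hs x hx, hs y hy]
      intro M' hM'
      obtain ⟨S', i', j', hS', rfl⟩ := decomp A b c M' hM'.1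
      have hcard' := hM'.2.1
      simp only [Multiset.card_add, Multiset.card_replicate] at hcard'
      obtain ⟨s', hs', -, hsum'⟩ := key S' i' j' hS' (by omega)
      have hee := small _ _ _ _ hs hs' (by rw [← hsum, ← hsum', hM.2.2, hM'.2.2])
      rcases arith h i j i' j' hh (by omega) (by omega) hee with ⟨rfl, rfl⟩ | h1 | h1
      · have hij : i + j ≠ 0 := by
          intro h0
          obtain ⟨rfl, rfl⟩ : i = 0 ∧ j = 0 := by omega
          simp at he
        rw [hsid' S' S i j hS' hS (by omega) (by omega) (by rw [hM.2.2, hM'.2.2])]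
      · exfalso; apply he; rw [h1.1, h1.2.1]; simp
      · exfalso; apply he; rw [hee, h1.1, h1.2.1]; simp
  · intro M M' hM hM' hcc hlt hsum
    obtain ⟨S, i, j, hS, rfl⟩ := decomp A b c M hM
    obtain ⟨S', i', j', hS', rfl⟩ := decomp A b c M' hM'
    simp only [Multiset.card_add, Multiset.card_replicate] at hcc hlt
    obtain ⟨s, hs, -, hsum1⟩ := key S i j hS (by omega)
    obtain ⟨s', hs', -, hsum2⟩ := key S' i' j' hS' (by omega)
    have hee := small _ _ _ _ hs hs' (by rw [← hsum1, ← hsum2, hsum])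
    rcases arith h i j i' j' hh (by omega) (by omega) hee with ⟨rfl, rfl⟩ | h1 | h1
    · rw [hsid' S S' i j hS hS' (by omega) (by omega) hsum]
    · omega
    · omega
  · rw [← Set.encard_insert_of_notMem hM0']
    apply Set.encard_le_encard
    exact Set.insert_subset hM0 (MRep_mono hsub h n)

/-- Nathanson: every function `f : ℤ → ℕ∞` with only finitely many zeros is the unordered
representation function of order `h` of some set of integers, for every `h ≥ 2`. -/
theorem stmt1 (h : ℕ) (hh : 2 ≤ h) (f : ℤ → ℕ∞)
    (hf : {n : ℤ | f n = 0}.Finite) :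
    ∃ A : Set ℤ, ∀ n : ℤ, unorderedRep A h n = f n := by
  have hstep : ∀ (n : ℤ) (A : {A : Set ℤ // GoodSet h f A}), ∃ A' : {A : Set ℤ // GoodSet h f A},
      A.1 ⊆ A'.1 ∧ ((MRep A.1 h n).encard < f n →
        (MRep A.1 h n).encard + 1 ≤ (MRep A'.1 h n).encard) := by
    intro n A
    by_cases hlt : (MRep A.1 h n).encard < f n
    · obtain ⟨A', h1, h2, h3⟩ := step h hh f hf A.1 A.2 n hlt
      exact ⟨⟨A', h2⟩, h1, fun _ => h3⟩
    · exact ⟨A, subset_rfl, fun hl => absurd hl hlt⟩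
  choose F hF1 hF2 using hstep
  have h0 : GoodSet h f ∅ := by
    refine ⟨Set.finite_empty, ?_, ?_⟩
    · intro n
      have : MRep ∅ h n = ∅ := by
        ext M
        simp only [Set.mem_empty_iff_false, iff_false]
        rintro ⟨h1, h2, -⟩
        have : M = 0 := Multiset.eq_zero_of_forall_notMem fun x hx => h1 x hx
        subst this
        simp at h2
        omega
      simp [this]
    · intro M M' hM hM' _ _ _
      rw [Multiset.eq_zero_of_forall_notMem fun x hx => hM x hx,
        Multiset.eq_zero_of_forall_notMem fun x hx => hM' x hx]
  let g : ℕ → ℤ := fun k => Equiv.intEquivNat.symm (Nat.unpair k).1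
  have hg : ∀ (n : ℤ) (k : ℕ), ∃ k', k ≤ k' ∧ g k' = n := fun n k =>
    ⟨Nat.pair (Equiv.intEquivNat n) k, Nat.right_le_pair _ _, by simp [g]⟩
  let a : ℕ → {A : Set ℤ // GoodSet h f A} := fun k =>
    Nat.rec ⟨∅, h0⟩ (fun k A => F (g k) A) k
  have ha : ∀ k, a (k + 1) = F (g k) (a k) := fun k => rfl
  have hmono : Monotone (fun k => (a k).1) :=
    monotone_nat_of_le_succ (fun k => by
      change (a k).1 ⊆ (a (k + 1)).1
      rw [ha]; exact hF1 _ _)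
  have hsubU : ∀ k, (a k).1 ⊆ ⋃ k, (a k).1 := fun k => Set.subset_iUnion (fun k => (a k).1) k
  refine ⟨⋃ k, (a k).1, fun n => ?_⟩
  rw [unorderedRep_eq]
  apply le_antisymm
  · by_contra hlt
    push Not at hlt
    have hft : f n ≠ ⊤ := ne_top_of_lt hlt
    obtain ⟨T, hT, hTc⟩ := Set.exists_subset_encard_eq (Order.add_one_le_of_lt hlt)
    have hTf : T.Finite := by
      apply Set.finite_of_encard_le_coe (k := (f n).toNat + 1)
      rw [hTc]
      push_cast
      rw [ENat.natCast_toNat hft]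
    have hM : ∀ M : Multiset ℤ, (∀ x ∈ M, x ∈ ⋃ k, (a k).1) → ∃ k, ∀ x ∈ M, x ∈ (a k).1 := by
      intro M
      induction M using Multiset.induction_on with
      | empty => exact fun _ => ⟨0, by simp⟩
      | cons y M ih =>
        intro hM
        obtain ⟨k, hk⟩ := ih (fun x hx => hM x (Multiset.mem_cons_of_mem hx))
        obtain ⟨k', hk'⟩ := Set.mem_iUnion.1 (hM y (Multiset.mem_cons_self _ _))
        refine ⟨max k k', fun x hx => ?_⟩
        rcases Multiset.mem_cons.1 hx with rfl | hx
        · exact hmono (le_max_right k k') hk'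
        · exact hmono (le_max_left k k') (hk x hx)
    have hTk : ∃ k, T ⊆ MRep (a k).1 h n := by
      have hM2 : ∀ M : Multiset ℤ, ∃ k, M ∈ T → ∀ x ∈ M, x ∈ (a k).1 := by
        intro M
        by_cases hMT : M ∈ T
        · obtain ⟨k, hk⟩ := hM M (hT hMT).1
          exact ⟨k, fun _ => hk⟩
        · exact ⟨0, fun hx => absurd hx hMT⟩
      choose κ hκ using hM2
      obtain ⟨K, hK⟩ := (hTf.image κ).bddAbove
      refine ⟨K, fun M hMT => ⟨fun x hx => ?_, (hT hMT).2⟩⟩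
      exact hmono (hK ⟨M, hMT, rfl⟩) (hκ M hMT x hx)
    obtain ⟨k, hk⟩ := hTk
    have h1 := (Set.encard_le_encard hk).trans ((a k).2.2.1 n)
    rw [hTc] at h1
    exact absurd h1 (not_le.2 (ENat.lt_add_one_iff hft |>.2 le_rfl))
  · by_contra hlt
    push Not at hlt
    have hj : ∀ j : ℕ, ∃ k, (j : ℕ∞) ≤ (MRep (a k).1 h n).encard := by
      intro j
      induction j with
      | zero => exact ⟨0, by simp⟩
      | succ j ih =>
        obtain ⟨k, hk⟩ := ih
        obtain ⟨k', hkk, hgk⟩ := hg n k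
        refine ⟨k' + 1, ?_⟩
        have h1 := Set.encard_le_encard (MRep_mono (hmono hkk) h n)
        have h2 := hF2 (g k') (a k')
        rw [← ha, hgk] at h2
        have h3 := h2 (lt_of_le_of_lt (Set.encard_le_encard (MRep_mono (hsubU k') h n)) hlt)
        refine le_trans ?_ h3
        push_cast
        exact add_le_add (hk.trans h1) le_rfl
    have htop : (MRep (⋃ k, (a k).1) h n).encard = ⊤ := by
      rw [ENat.eq_top_iff_forall_ge]
      intro j
      obtain ⟨k, hk⟩ := hj j
      exact hk.trans (Set.encard_le_encard (MRep_mono (hsubU k) h n))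
    rw [htop] at hlt
    exact absurd hlt not_top_lt
end

section
/- Let f(x₁,x₂) = u₁x₁ + u₂x₂ and g(x₁,x₂) = v₁x₁ + v₂x₂ be distinct normalized binary linear forms with integer coefficients. Then there exist finite sets A and A' of integers such that |f(A)| < |g(A)| and |f(A')| > |g(A')|, where f(A) = {u₁a₁ + u₂a₂ : a₁, a₂ ∈ A}. -/
/-- The image of a finite set `A` of integers under the binary linear form
`f(x₁,x₂) = u₁x₁ + u₂x₂`. -/
def formImage (u₁ u₂ : ℤ) (A : Finset ℤ) : Finset ℤ :=
  (A ×ˢ A).image (fun p => u₁ * p.1 + u₂ * p.2)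

/-! ### Generic projections -/

/-- Value set of a form on a family in an abelian group, together with projections to `ℤ`. -/
def GoodGrp (G : Type) [AddCommGroup G] : Prop :=
  ∀ S : Finset G, ∃ φ : G →+ ℤ, Set.InjOn φ (S : Set G)

lemma goodGrp_int : GoodGrp ℤ := fun _ => ⟨AddMonoidHom.id ℤ, fun _ _ _ _ h => h⟩

lemma goodGrp_prod {G : Type} [AddCommGroup G] (hG : GoodGrp G) : GoodGrp (ℤ × G) := by
  classical
  intro S
  obtain ⟨φ, hφ⟩ := hG (S.image Prod.snd)
  let t : ℤ := 1 + 2 * ∑ x ∈ S, |x.1|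
  have hb : ∀ x ∈ S, |x.1| ≤ ∑ x ∈ S, |x.1| := fun x hx =>
    Finset.single_le_sum (f := fun x : ℤ × G => |x.1|) (fun i _ => abs_nonneg _) hx
  refine ⟨(AddMonoidHom.fst ℤ G) + t • (φ.comp (AddMonoidHom.snd ℤ G)), ?_⟩
  intro x hx y hy h
  simp at h
  have h1 := hb x hx
  have h2 := hb y hy
  rw [abs_le] at h1 h2
  have h3 : t * (φ x.2 - φ y.2) = y.1 - x.1 := by linarith
  have h4 : φ x.2 - φ y.2 = 0 := by
    by_contra hne
    have ht : |t| ≤ |y.1 - x.1| := by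
      rw [← h3, abs_mul]
      exact le_mul_of_one_le_right (abs_nonneg _) (Int.one_le_abs hne)
    have : t ≤ |y.1 - x.1| := (le_abs_self t).trans ht
    rcases abs_cases (y.1 - x.1) with h | h <;> simp only [t] at this <;> linarith
  have h5 : x.1 = y.1 := by rw [h4] at h3; linarith
  have h6 : x.2 = y.2 := hφ (by simpa using ⟨x.1, hx⟩) (by simpa using ⟨y.1, hy⟩) (by linarith)
  exact Prod.ext h5 h6

/-- Transfer: a finite family in a good group, where `f` takes few values and `g` many. -/
lemma transfer {G ι : Type} [AddCommGroup G] [Fintype ι] [DecidableEq ι] (hG : GoodGrp G)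
    (u₁ u₂ v₁ v₂ : ℤ) (a : ι → G) (T T' : Finset (ι × ι)) (hT : T.card < T'.card)
    (hf : ∀ p : ι × ι, ∃ q ∈ T, u₁ • a p.1 + u₂ • a p.2 = u₁ • a q.1 + u₂ • a q.2)
    (hg : ∀ p ∈ T', ∀ q ∈ T', v₁ • a p.1 + v₂ • a p.2 = v₁ • a q.1 + v₂ • a q.2 → p = q) :
    ∃ A : Finset ℤ, (formImage u₁ u₂ A).card < (formImage v₁ v₂ A).card := by
  classical
  obtain ⟨φ, hφ⟩ := hG (T'.image fun p => v₁ • a p.1 + v₂ • a p.2)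
  refine ⟨Finset.univ.image fun i => φ (a i), ?_⟩
  have key : ∀ (w₁ w₂ : ℤ) (p : ι × ι), w₁ * φ (a p.1) + w₂ * φ (a p.2)
      = φ (w₁ • a p.1 + w₂ • a p.2) := by
    intro w₁ w₂ p; simp
  calc (formImage u₁ u₂ (Finset.univ.image fun i => φ (a i))).card
      ≤ (T.image fun q => φ (u₁ • a q.1 + u₂ • a q.2)).card := by
        apply Finset.card_le_card
        intro x hx
        simp only [formImage, Finset.mem_image, Finset.mem_product, Finset.mem_univ,
          true_and] at hx
        obtain ⟨⟨_, _⟩, ⟨⟨i, rfl⟩, ⟨j, rfl⟩⟩, rfl⟩ := hx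
        obtain ⟨q, hq, h⟩ := hf (i, j)
        refine Finset.mem_image.2 ⟨q, hq, ?_⟩
        rw [← h, ← key]
    _ ≤ T.card := Finset.card_image_le
    _ < T'.card := hT
    _ = (T'.image fun q => φ (v₁ • a q.1 + v₂ • a q.2)).card := by
        rw [Finset.card_image_of_injOn]
        intro p hp q hq h
        apply hg p hp q hq
        exact hφ (by simpa using ⟨p.1, p.2, hp, rfl⟩) (by simpa using ⟨q.1, q.2, hq, rfl⟩) h
    _ ≤ _ := by
        apply Finset.card_le_card
        intro x hx
        obtain ⟨q, hq, rfl⟩ := Finset.mem_image.1 hx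
        rw [← key]
        refine Finset.mem_image.2 ⟨(φ (a q.1), φ (a q.2)), ?_, rfl⟩
        simp

/-! ### Case 1 -/

lemma two_inj (α β : ℤ) (h1 : α ≠ 0) (h2 : β ≠ 0) (h3 : α ≠ β) (h4 : α ≠ -β) (i j i' j' : Fin 2)
    (h : α * (i : ℤ) + β * (j : ℤ) = α * (i' : ℤ) + β * (j' : ℤ)) : i = i' ∧ j = j' := by
  fin_cases i <;> fin_cases j <;> fin_cases i' <;> fin_cases j' <;>
      simp at h ⊢ <;> omega

lemma case_one (u₁ u₂ v₁ v₂ : ℤ) (hu1 : |u₂| ≤ u₁) (hu2 : 1 ≤ |u₂|) (hv1 : |v₂| < v₁)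
    (hv2 : 1 ≤ |v₂|) (h1 : v₁ * u₂ ≠ v₂ * u₁) (h2 : v₁ * u₂ ≠ - (v₂ * u₁)) :
    ∃ A : Finset ℤ, (formImage u₁ u₂ A).card < (formImage v₁ v₂ A).card := by
  have hu2' : u₂ ≠ 0 := by rintro rfl; simp at hu2
  have hv2' : v₂ ≠ 0 := by rintro rfl; simp at hv2
  have hu1' : 0 < u₁ := by linarith
  have hv1' : 0 < v₁ := by linarith
  have h34 : |v₂ * u₂| < v₁ * u₁ := by
    rw [abs_mul]; nlinarith
  rw [abs_lt] at h34 hv1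
  have m1 : v₁ * u₁ ≠ 0 := by positivity
  have m2 : v₁ * u₂ ≠ 0 := by positivity
  have m3 : v₂ * u₁ ≠ 0 := by positivity
  have m4 : v₂ * u₂ ≠ 0 := by positivity
  have m5 : v₁ * u₁ ≠ v₂ * u₁ := fun h => by nlinarith [mul_right_cancel₀ hu1'.ne' h]
  have m6 : v₁ * u₂ ≠ v₂ * u₂ := fun h => by nlinarith [mul_right_cancel₀ hu2' h]
  have m7 : v₁ * u₁ ≠ - (v₂ * u₁) := fun h => by
    rw [← neg_mul] at h; nlinarith [mul_right_cancel₀ hu1'.ne' h]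
  have m8 : v₁ * u₂ ≠ - (v₂ * u₂) := fun h => by
    rw [← neg_mul] at h; nlinarith [mul_right_cancel₀ hu2' h]
  let c : Fin 2 → ℤ := ![u₂, u₁]
  have hc : ∀ b, c b ≠ 0 := by
    intro b; fin_cases b <;> simp [c, hu2', hu1'.ne']
  have key : ∀ b d, v₁ * c b ≠ v₂ * c d ∧ v₁ * c b ≠ -(v₂ * c d) := by
    intro b d
    fin_cases b <;> fin_cases d
    · exact ⟨m6, m8⟩
    · exact ⟨h1, h2⟩
    · exact ⟨fun h => by simp [c] at h; linarith, fun h => by simp [c] at h; linarith⟩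
    · exact ⟨m5, m7⟩
  let a : Fin 2 × Fin 2 → ℤ × ℤ := fun p => (c p.1 * (p.2 : ℤ), (p.1 : ℤ))
  refine transfer (goodGrp_prod goodGrp_int) u₁ u₂ v₁ v₂ a
    (Finset.univ.erase ((0, 0), (1, 1))) Finset.univ (by decide) ?_ ?_
  · intro p
    by_cases hp : p = ((0, 0), (1, 1))
    · subst hp
      refine ⟨((0, 1), (1, 0)), by decide, ?_⟩
      simp [a, c, mul_comm]
    · exact ⟨p, by simp [hp], rfl⟩
  · rintro ⟨⟨b, i⟩, ⟨d, j⟩⟩ - ⟨⟨b', i'⟩, ⟨d', j'⟩⟩ - h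
    simp only [a, Prod.smul_mk, Prod.mk_add_mk, Prod.mk.injEq, smul_eq_mul] at h
    obtain ⟨h, h0⟩ := h
    have hb : b = b' ∧ d = d' := by
      clear h key
      fin_cases b <;> fin_cases b' <;> fin_cases d <;> fin_cases d' <;> simp at h0 ⊢ <;> omega
    obtain ⟨rfl, rfl⟩ := hb
    obtain ⟨rfl, rfl⟩ := two_inj (v₁ * c b) (v₂ * c d) (mul_ne_zero hv1'.ne' (hc b))
      (mul_ne_zero hv2' (hc d)) (key b d).1 (key b d).2 i j i' j' (by linarith)
    rfl

/-! ### Case 3 -/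

/-- The points `0, e₁, e₂` of the plane. -/
def kpt : Fin 3 → ℤ × ℤ := ![(0, 0), (1, 0), (0, 1)]

lemma kpt_inj (α β : ℤ) (h1 : α ≠ 0) (h2 : β ≠ 0) (h3 : α ≠ β) (h4 : α ≠ -β) (i j i' j' : Fin 3)
    (h : α • kpt i + β • kpt j = α • kpt i' + β • kpt j') : i = i' ∧ j = j' := by
  fin_cases i <;> fin_cases j <;> fin_cases i' <;> fin_cases j' <;>
      simp [kpt] at h ⊢ <;> omega

lemma kpt_inj' (α : ℤ) (h1 : α ≠ 0) (i j i' j' : Fin 3) (hi : i = j → i = 0)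
    (hi' : i' = j' → i' = 0)
    (h : α • kpt i + (-α) • kpt j = α • kpt i' + (-α) • kpt j') : i = i' ∧ j = j' := by
  fin_cases i <;> fin_cases j <;> fin_cases i' <;> fin_cases j' <;>
      simp [kpt] at h hi hi' ⊢ <;> omega

lemma case_three (u₁ u₂ : ℤ) (hu1 : |u₂| < u₁) (hu2 : 1 ≤ |u₂|) :
    ∃ A : Finset ℤ, (formImage u₁ u₂ A).card < (formImage u₁ (-u₂) A).card := by
  have hu2' : u₂ ≠ 0 := by rintro rfl; simp at hu2
  have hu1' : 0 < u₁ := by linarith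
  have hsq : u₂ * u₂ < u₁ * u₁ := by
    rw [← abs_mul_abs_self u₂]; nlinarith
  have hsq' : 0 < u₂ * u₂ := mul_self_pos.2 hu2'
  rw [abs_lt] at hu1
  let c : Fin 2 → ℤ := ![u₂, u₁]
  have hc : ∀ b, c b ≠ 0 := by
    intro b; fin_cases b <;> simp [c, hu2', hu1'.ne']
  let a : Fin 2 × Fin 3 → ℤ × (ℤ × ℤ) := fun p => ((p.1 : ℤ), c p.1 • kpt p.2)
  refine transfer (goodGrp_prod (goodGrp_prod goodGrp_int)) u₁ u₂ u₁ (-u₂) a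
    (Finset.univ.filter fun p => p.1.1 = 0 → p.2.1 = 1 → p.1.2 ≤ p.2.2)
    (Finset.univ.filter fun p => p.1.1 = 0 → p.2.1 = 1 → p.1.2 = p.2.2 → p.1.2 = 0)
    (by decide) ?_ ?_
  · rintro ⟨⟨b, i⟩, ⟨b', i'⟩⟩
    by_cases hp : b = 0 ∧ b' = 1 ∧ i' < i
    · obtain ⟨rfl, rfl, hi⟩ := hp
      refine ⟨((0, i'), (1, i)), by simp [hi.le], ?_⟩
      simp only [a, c]
      ext <;> simp <;> ring
    · refine ⟨_, ?_, rfl⟩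
      simp only [Finset.mem_filter, Finset.mem_univ, true_and]
      intro h1 h2
      by_contra h3
      exact hp ⟨h1, h2, not_le.1 h3⟩
  · rintro ⟨⟨b, i⟩, ⟨d, j⟩⟩ hp ⟨⟨b', i'⟩, ⟨d', j'⟩⟩ hq h
    simp only [Finset.mem_filter, Finset.mem_univ, true_and] at hp hq
    simp only [a, Prod.smul_mk, Prod.mk_add_mk, Prod.mk.injEq, smul_smul] at h
    obtain ⟨h0, h⟩ := h
    have hb : b = b' ∧ d = d' := by
      clear h hp hq
      fin_cases b <;> fin_cases b' <;> fin_cases d <;> fin_cases d' <;> simp at h0 ⊢ <;> omega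
    obtain ⟨rfl, rfl⟩ := hb
    by_cases hbd : b = 0 ∧ d = 1
    · obtain ⟨rfl, rfl⟩ := hbd
      have e : -u₂ * c 1 = -(u₁ * c 0) := by simp [c]; ring
      rw [e] at h
      obtain ⟨rfl, rfl⟩ := kpt_inj' (u₁ * c 0) (mul_ne_zero hu1'.ne' (hc 0)) i j i' j'
        (hp rfl rfl) (hq rfl rfl) h
      rfl
    · have key : u₁ * c b ≠ -u₂ * c d ∧ u₁ * c b ≠ -(-u₂ * c d) := by
        have n1 : u₁ * u₂ ≠ u₂ * u₂ := fun h => by nlinarith [mul_right_cancel₀ hu2' h]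
        have n2 : u₁ * u₂ ≠ (-u₂) * u₂ := fun h => by nlinarith [mul_right_cancel₀ hu2' h]
        have n3 : u₁ * u₁ ≠ u₂ * u₁ := fun h => by nlinarith [mul_right_cancel₀ hu1'.ne' h]
        have n4 : u₁ * u₁ ≠ (-u₂) * u₁ := fun h => by nlinarith [mul_right_cancel₀ hu1'.ne' h]
        fin_cases b <;> fin_cases d <;> simp [c] at hbd n1 n2 n3 n4 ⊢ <;> constructor <;>
          first | assumption | (intro hh; linarith)
      obtain ⟨rfl, rfl⟩ := kpt_inj (u₁ * c b) (-u₂ * c d) (mul_ne_zero hu1'.ne' (hc b))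
        (mul_ne_zero (neg_ne_zero.2 hu2') (hc d)) key.1 key.2 i j i' j' h
      rfl

/-! ### Case 2 -/

/-- Sums `∑ k < n, c k * d k` with `0 ≤ c k ≤ r k`. -/
def boxSet (d : ℕ → ℤ) (r : ℕ → ℕ) : ℕ → Finset ℤ
  | 0 => {0}
  | n + 1 => (boxSet d r n ×ˢ Finset.range (1 + r n)).image fun p => p.1 + p.2 * d n

lemma card_boxSet (d : ℕ → ℤ) (r : ℕ → ℕ) (n : ℕ) :
    (boxSet d r n).card ≤ ∏ k ∈ Finset.range n, (1 + r k) := by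
  induction n with
  | zero => simp [boxSet]
  | succ n ih =>
    rw [Finset.prod_range_succ, boxSet]
    refine Finset.card_image_le.trans ?_
    rw [Finset.card_product, Finset.card_range]
    exact Nat.mul_le_mul_right _ ih

lemma mem_boxSet (d : ℕ → ℤ) (r : ℕ → ℕ) (n : ℕ) (x : ℤ) :
    x ∈ boxSet d r n ↔
      ∃ c : ℕ → ℕ, (∀ k < n, c k ≤ r k) ∧ x = ∑ k ∈ Finset.range n, (c k : ℤ) * d k := by
  induction n generalizing x with
  | zero => simp [boxSet]
  | succ n ih =>
    simp only [boxSet, Finset.mem_image, Finset.mem_product, Finset.mem_range, Prod.exists]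
    constructor
    · rintro ⟨y, e, ⟨hy, he⟩, rfl⟩
      obtain ⟨c, hc, rfl⟩ := (ih y).1 hy
      refine ⟨fun k => if k < n then c k else e, ?_, ?_⟩
      · intro k hk
        by_cases h : k < n
        · simp [h, hc k h]
        · have : k = n := by omega
          subst this; simp; omega
      · rw [Finset.sum_range_succ]
        simp only [lt_irrefl, if_false]
        congr 1
        apply Finset.sum_congr rfl
        intro k hk
        simp [Finset.mem_range.1 hk]
    · rintro ⟨c, hc, rfl⟩
      refine ⟨_, c n, ⟨(ih _).2 ⟨c, fun k hk => hc k (by omega), rfl⟩, ?_⟩, ?_⟩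
      · have := hc n (by omega); omega
      · rw [Finset.sum_range_succ]

/-- The two patterns: positions `0,1 mod 4` and positions `2,3 mod 4` below `N`. -/
def pat (N : ℕ) (b : Bool) (k : ℕ) : ℕ :=
  if k < N ∧ (decide (k % 4 < 2) = b) then 1 else 0

/-- Combined pattern `S ∪ (S' + 1)` with multiplicity. -/
def pat2 (N : ℕ) (b b' : Bool) (k : ℕ) : ℕ :=
  pat N b k + (if k = 0 then 0 else pat N b' (k - 1))

lemma box_form (N : ℕ) (u₁ u₂ : ℤ) (d : ℕ → ℤ) (hd : ∀ k < N, u₂ * d k = u₁ * d (k + 1))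
    (b b' : Bool) (x y : ℤ) (hx : x ∈ boxSet d (pat N b) N) (hy : y ∈ boxSet d (pat N b') N) :
    u₁ * x + u₂ * y ∈ (boxSet d (pat2 N b b') (N + 1)).image (fun z => u₁ * z) := by
  obtain ⟨c, hc, rfl⟩ := (mem_boxSet _ _ _ _).1 hx
  obtain ⟨c', hc', rfl⟩ := (mem_boxSet _ _ _ _).1 hy
  refine Finset.mem_image.2 ⟨_, (mem_boxSet _ _ _ _).2
    ⟨fun k => (if k < N then c k else 0) + (if k = 0 then 0 else c' (k - 1)), ?_, rfl⟩, ?_⟩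
  · intro k hk
    unfold pat2
    apply Nat.add_le_add
    · split_ifs with h
      · exact hc k h
      · simp
    · split_ifs with h
      · simp
      · exact hc' _ (by omega)
  · push_cast
    simp only [add_mul, Finset.sum_add_distrib, mul_add]
    congr 1
    · rw [Finset.sum_range_succ]
      simp only [lt_irrefl, if_false, zero_mul, add_zero]
      congr 1
      apply Finset.sum_congr rfl
      intro k hk
      simp [Finset.mem_range.1 hk]
    · rw [Finset.sum_range_succ']
      simp only [if_true, zero_mul, add_zero, Finset.mul_sum]
      apply Finset.sum_congr rfl
      intro k hk
      have := hd k (Finset.mem_range.1 hk)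
      simp
      linear_combination (-(c' k : ℤ)) * this

/-- Subset sums of `σ k * d k`, `k < n`. -/
def subSums (e : ℕ → ℤ) : ℕ → Finset ℤ
  | 0 => {0}
  | n + 1 => subSums e n ∪ (subSums e n).image fun x => x + e n

lemma card_subSums (u₁ : ℤ) (e : ℕ → ℤ) (N : ℕ) (h1 : ∀ k < N, u₁ ^ (N - k) ∣ e k)
    (h2 : ∀ k < N, ¬ u₁ ^ (N - k + 1) ∣ e k) (n : ℕ) (hn : n ≤ N) :
    (subSums e n).card = 2 ^ n ∧ ∀ x ∈ subSums e n, u₁ ^ (N - n + 1) ∣ x := by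
  induction n with
  | zero => simp [subSums]
  | succ n ih =>
    obtain ⟨ih1, ih2⟩ := ih (by omega)
    constructor
    · rw [subSums, Finset.card_union_of_disjoint, Finset.card_image_of_injective, ih1]
      · ring
      · exact add_left_injective _
      · rw [Finset.disjoint_left]
        intro x hx hx'
        obtain ⟨y, hy, rfl⟩ := Finset.mem_image.1 hx'
        exact h2 n (by omega) ((Int.dvd_iff_dvd_of_dvd_add (ih2 _ hx)).1 (ih2 y hy))
    · have e1 : N - (n + 1) + 1 = N - n := by omega
      rw [e1]
      have hx : ∀ x ∈ subSums e n, u₁ ^ (N - n) ∣ x := fun x hx =>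
        (pow_dvd_pow _ (by omega)).trans (ih2 x hx)
      intro x hx'
      rw [subSums, Finset.mem_union] at hx'
      rcases hx' with h | h
      · exact hx x h
      · obtain ⟨y, hy, rfl⟩ := Finset.mem_image.1 h
        exact dvd_add (hx y hy) (h1 n (by omega))

lemma subSums_sub (N : ℕ) (d : ℕ → ℤ) (τ : ℤ) (n : ℕ) (hn : n ≤ N) (x : ℤ)
    (hx : x ∈ subSums (fun k => (if k % 4 < 2 then 1 else τ) * d k) n) :
    ∃ y ∈ boxSet d (pat N true) n, ∃ z ∈ boxSet d (pat N false) n, x = y + τ * z := by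
  induction n generalizing x with
  | zero => simpa [subSums, boxSet] using hx
  | succ n ih =>
    have step : ∀ (b : Bool) (y : ℤ), y ∈ boxSet d (pat N b) n → y ∈ boxSet d (pat N b) (n + 1) := by
      intro b y hy
      rw [boxSet]
      exact Finset.mem_image.2 ⟨(y, 0), by simp [hy], by simp⟩
    have step' : ∀ (b : Bool) (y : ℤ), pat N b n = 1 → y ∈ boxSet d (pat N b) n →
        y + d n ∈ boxSet d (pat N b) (n + 1) := by
      intro b y hb hy
      rw [boxSet]
      exact Finset.mem_image.2 ⟨(y, 1), by simp [hy, hb], by simp⟩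
    rw [subSums, Finset.mem_union] at hx
    rcases hx with h | h
    · obtain ⟨y, hy, z, hz, rfl⟩ := ih (by omega) x h
      exact ⟨y, step _ _ hy, z, step _ _ hz, rfl⟩
    · obtain ⟨x', hx', rfl⟩ := Finset.mem_image.1 h
      obtain ⟨y, hy, z, hz, rfl⟩ := ih (by omega) x' hx'
      by_cases hm : n % 4 < 2
      · exact ⟨y + d n, step' _ _ (by simp [pat, hm]; omega) hy, z, step _ _ hz, by simp [hm]; ring⟩
      · exact ⟨y, step _ _ hy, z + d n, step' _ _ (by simp [pat, hm]; omega) hz, by simp [hm]; ring⟩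

lemma pat_num : ∏ k ∈ Finset.range (24 + 1), (1 + pat2 24 true true k)
       + ∏ k ∈ Finset.range (24 + 1), (1 + pat2 24 true false k)
       + ∏ k ∈ Finset.range (24 + 1), (1 + pat2 24 false true k)
       + ∏ k ∈ Finset.range (24 + 1), (1 + pat2 24 false false k) < 2 ^ 24 := by
  decide +kernel

lemma case_two (u₁ u₂ τ : ℤ) (hu : Int.gcd u₁ u₂ = 1) (hu1 : 1 < u₁) (hτ : τ = 1 ∨ τ = -1) :
    ∃ A : Finset ℤ, (formImage u₁ u₂ A).card < (formImage 1 τ A).card := by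
  classical
  obtain ⟨N, hN⟩ : ∃ N : ℕ, N = 24 := ⟨_, rfl⟩
  let d : ℕ → ℤ := fun k => u₁ ^ (N - k) * u₂ ^ k
  have hd : ∀ k < N, u₂ * d k = u₁ * d (k + 1) := by
    intro k hk
    have : N - k = (N - (k + 1)) + 1 := by omega
    simp only [d]
    rw [this, pow_succ, pow_succ]; ring
  have hcop : IsCoprime u₁ u₂ := Int.isCoprime_iff_gcd_eq_one.2 hu
  have hnd : ∀ k < N, ¬ u₁ ^ (N - k + 1) ∣ d k := by
    intro k hk h
    simp only [d] at h
    rw [pow_succ] at h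
    have h' := Int.dvd_of_mul_dvd_mul_left (a := u₁ ^ (N - k)) (by positivity) h
    have h'' := (hcop.pow_right (n := k)).isUnit_of_dvd' dvd_rfl h'
    rcases Int.isUnit_iff.1 h'' with h | h <;> omega
  let P : Bool → Finset ℤ := fun b => boxSet d (pat N b) N
  refine ⟨P true ∪ P false, ?_⟩
  have hP : ∀ x ∈ P true ∪ P false, ∃ b, x ∈ P b := by
    intro x hx
    rcases Finset.mem_union.1 hx with h | h
    exacts [⟨_, h⟩, ⟨_, h⟩]
  have up : (formImage u₁ u₂ (P true ∪ P false)).card < 2 ^ N := by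
    let Q : Bool → Bool → Finset ℤ := fun b b' =>
      (boxSet d (pat2 N b b') (N + 1)).image (fun z => u₁ * z)
    have hQ : ∀ b b', (Q b b').card ≤ ∏ k ∈ Finset.range (N + 1), (1 + pat2 N b b' k) := fun b b' =>
      Finset.card_image_le.trans (card_boxSet _ _ _)
    have hsub : formImage u₁ u₂ (P true ∪ P false) ⊆
        (Q true true ∪ Q true false) ∪ (Q false true ∪ Q false false) := by
      intro x hx
      obtain ⟨⟨y, z⟩, hyz, rfl⟩ := Finset.mem_image.1 hx
      rw [Finset.mem_product] at hyz
      obtain ⟨b, hb⟩ := hP _ hyz.1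
      obtain ⟨b', hb'⟩ := hP _ hyz.2
      have := box_form N u₁ u₂ d hd b b' y z hb hb'
      have h : u₁ * y + u₂ * z ∈ Q b b' := this
      simp only [Finset.mem_union]
      cases b <;> cases b' <;> simp [h]
    have := Finset.card_le_card hsub
    have a1 := Finset.card_union_le (Q true true ∪ Q true false) (Q false true ∪ Q false false)
    have a2 := Finset.card_union_le (Q true true) (Q true false)
    have a3 := Finset.card_union_le (Q false true) (Q false false)
    have num : ∏ k ∈ Finset.range (N + 1), (1 + pat2 N true true k)
       + ∏ k ∈ Finset.range (N + 1), (1 + pat2 N true false k)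
       + ∏ k ∈ Finset.range (N + 1), (1 + pat2 N false true k)
       + ∏ k ∈ Finset.range (N + 1), (1 + pat2 N false false k) < 2 ^ N := by
      subst hN
      exact pat_num
    clear hN
    have := hQ true true
    have := hQ true false
    have := hQ false true
    have := hQ false false
    omega
  refine up.trans_le ?_
  let e : ℕ → ℤ := fun k => (if k % 4 < 2 then 1 else τ) * d k
  have hdvd : ∀ (m : ℤ) (k : ℕ), m ∣ e k ↔ m ∣ d k := by
    intro m k
    simp only [e]
    split_ifs
    · simp
    · rcases hτ with rfl | rfl <;> simp
  have hc := (card_subSums u₁ e N (fun k _ => (hdvd _ _).2 (Dvd.intro _ rfl))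
    (fun k hk h => hnd k hk ((hdvd _ _).1 h)) N le_rfl).1
  rw [← hc]
  apply Finset.card_le_card
  intro x hx
  obtain ⟨y, hy, z, hz, rfl⟩ := subSums_sub N d τ N le_rfl x hx
  refine Finset.mem_image.2 ⟨(y, z), ?_, by simp⟩
  simp only [Finset.mem_product, Finset.mem_union]
  exact ⟨Or.inl hy, Or.inr hz⟩

/-! ### Assembly -/

lemma one_of_eq (v₁ v₂ : ℤ) (hv : Int.gcd v₁ v₂ = 1) (hv1 : |v₂| = v₁) :
    v₁ = 1 ∧ (v₂ = 1 ∨ v₂ = -1) := by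
  have h : v₁ = 1 := by
    have : Int.gcd v₁ v₂ = v₁.natAbs := by
      apply Int.gcd_eq_natAbs_left
      rw [← hv1]; exact (abs_dvd _ _).2 dvd_rfl
    rw [hv] at this
    have := abs_nonneg v₂
    omega
  refine ⟨h, ?_⟩
  rw [h] at hv1
  exact eq_or_eq_neg_of_abs_eq hv1

lemma ratio_eq (u₁ u₂ v₁ v₂ : ℤ) (hu : Int.gcd u₁ u₂ = 1) (hv : Int.gcd v₁ v₂ = 1)
    (hu1 : 0 < u₁) (hv1 : 0 < v₁) (h : v₁ * u₂ = v₂ * u₁) : u₁ = v₁ ∧ u₂ = v₂ := by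
  have cu : IsCoprime u₁ u₂ := Int.isCoprime_iff_gcd_eq_one.2 hu
  have cv : IsCoprime v₁ v₂ := Int.isCoprime_iff_gcd_eq_one.2 hv
  have d1 : u₁ ∣ v₁ := cu.dvd_of_dvd_mul_right (h ▸ Dvd.intro_left _ rfl)
  have d2 : v₁ ∣ u₁ := cv.dvd_of_dvd_mul_left (h ▸ Dvd.intro _ rfl)
  have e : u₁ = v₁ := Int.dvd_antisymm hu1.le hv1.le d1 d2
  refine ⟨e, ?_⟩
  subst e
  rw [mul_comm] at h
  exact mul_right_cancel₀ hu1.ne' h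

lemma one_side (u₁ u₂ v₁ v₂ : ℤ)
    (hu : Int.gcd u₁ u₂ = 1) (hu1 : |u₂| ≤ u₁) (hu2 : 1 ≤ |u₂|)
    (hv : Int.gcd v₁ v₂ = 1) (hv1 : |v₂| ≤ v₁) (hv2 : 1 ≤ |v₂|)
    (hne : (u₁, u₂) ≠ (v₁, v₂)) :
    ∃ A : Finset ℤ, (formImage u₁ u₂ A).card < (formImage v₁ v₂ A).card := by
  have hup : 0 < u₁ := by linarith
  have hvp : 0 < v₁ := by linarith
  rcases hv1.lt_or_eq with hlt | heq
  · by_cases h1 : v₁ * u₂ = v₂ * u₁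
    · obtain ⟨rfl, rfl⟩ := ratio_eq u₁ u₂ v₁ v₂ hu hv hup hvp h1
      exact absurd rfl hne
    by_cases h2 : v₁ * u₂ = -(v₂ * u₁)
    · obtain ⟨rfl, rfl⟩ := ratio_eq u₁ u₂ v₁ (-v₂) hu (by simpa using hv) hup hvp (by linarith)
      simpa using case_three u₁ (-v₂) (by simpa using hlt) (by simpa using hv2)
    exact case_one u₁ u₂ v₁ v₂ hu1 hu2 hlt hv2 h1 h2
  · obtain ⟨rfl, hτ⟩ := one_of_eq v₁ v₂ hv heq
    rcases hu1.lt_or_eq with hult | hueq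
    · exact case_two u₁ u₂ v₂ hu (by linarith) hτ
    · obtain ⟨rfl, hτ'⟩ := one_of_eq u₁ u₂ hu hueq
      rcases hτ with rfl | rfl <;> rcases hτ' with rfl | rfl
      · exact absurd rfl hne
      · exact ⟨{0, 2, 3, 4, 7, 11, 12, 14}, by decide +kernel⟩
      · exact ⟨{0, 1, 3}, by decide +kernel⟩
      · exact absurd rfl hne

/-- Nathanson–O'Bryant–Orosz–Ruzsa–Silva: for distinct normalized binary linear forms
`f` and `g`, there exist finite sets `A`, `A'` of integers with `|f(A)| < |g(A)|` and
`|f(A')| > |g(A')|`. A form `u₁x₁+u₂x₂` is normalized if `gcd(u₁,u₂)=1` and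
`u₁ ≥ |u₂| ≥ 1`. -/
theorem stmt5 (u₁ u₂ v₁ v₂ : ℤ)
    (hu : Int.gcd u₁ u₂ = 1) (hu1 : |u₂| ≤ u₁) (hu2 : 1 ≤ |u₂|)
    (hv : Int.gcd v₁ v₂ = 1) (hv1 : |v₂| ≤ v₁) (hv2 : 1 ≤ |v₂|)
    (hne : (u₁, u₂) ≠ (v₁, v₂)) :
    (∃ A : Finset ℤ, (formImage u₁ u₂ A).card < (formImage v₁ v₂ A).card) ∧
    (∃ A' : Finset ℤ, (formImage v₁ v₂ A').card < (formImage u₁ u₂ A').card) := by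
  exact ⟨one_side u₁ u₂ v₁ v₂ hu hu1 hu2 hv hv1 hv2 hne,
    one_side v₁ v₂ u₁ u₂ hv hv1 hv2 hu hu1 hu2 hne.symm⟩
end

section
/- Fix an integer h ≥ 2. Call a real number λ > 0 an additive eigenvalue of order h if there exists a set A of nonnegative integers, with elements listed in increasing order as a₁ < a₂ < a₃ < ⋯, such that ℕ₀ \ hA is finite and a_n/(λn^h) → 1 as n → ∞. Let Λ_h denote the set of additive eigenvalues of order h. Then there exists a real number λ*_h > 0 such that the open interval (0, λ*_h) is contained in Λ_h and Λ_h is contained in the half-open interval (0, λ*_h]; that is, Λ_h = (0, λ*_h) or Λ_h = (0, λ*_h]. -/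
open Filter

/-- The `h`-fold sumset of a set `A` of nonnegative integers. -/
def hsumSet (h : ℕ) (A : Set ℕ) : Set ℕ :=
  {n | ∃ f : Fin h → ℕ, (∀ i, f i ∈ A) ∧ ∑ i, f i = n}

/-- `lam > 0` is an additive eigenvalue of order `h`: there is a strictly increasing
sequence `a₁ < a₂ < ⋯` of nonnegative integers whose underlying set is an asymptotic
basis of order `h` and `a_n ∼ lam · nᵸ`. -/
def IsAdditiveEigenvalue (h : ℕ) (lam : ℝ) : Prop :=
  0 < lam ∧ ∃ a : ℕ → ℕ, StrictMono a ∧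
    {n : ℕ | n ∉ hsumSet h (a '' Set.Ici 1)}.Finite ∧
    Tendsto (fun n : ℕ => (a n : ℝ) / (lam * (n : ℝ) ^ h)) atTop (nhds 1)


/-- The real `h`-th root of a natural number. -/
noncomputable def rt (h x : ℕ) : ℝ := (x : ℝ) ^ ((h : ℝ)⁻¹)

lemma rt_nonneg (h x : ℕ) : 0 ≤ rt h x := Real.rpow_nonneg (Nat.cast_nonneg x) _

lemma rt_pow (h x : ℕ) (hh : 2 ≤ h) : rt h x ^ h = x :=
  Real.rpow_inv_natCast_pow (Nat.cast_nonneg x) (by omega)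

lemma rt_mono (h : ℕ) {x y : ℕ} (hxy : x ≤ y) : rt h x ≤ rt h y :=
  Real.rpow_le_rpow (Nat.cast_nonneg x) (by exact_mod_cast hxy) (by positivity)

lemma rt_one_le (h x : ℕ) (hx : 1 ≤ x) : 1 ≤ rt h x := by
  apply Real.one_le_rpow (by exact_mod_cast hx) (by positivity)

lemma rt_tendsto (h : ℕ) (hh : 2 ≤ h) : Tendsto (rt h) atTop atTop := by
  have h0 : (0:ℝ) < (h:ℝ)⁻¹ := by
    have : (0:ℝ) < h := by exact_mod_cast (by omega : 0 < h)
    positivity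
  exact (tendsto_rpow_atTop h0).comp tendsto_natCast_atTop_atTop

lemma pow_diff_le (h : ℕ) (u v : ℝ) (hv : 0 ≤ v) (huv : v ≤ u) :
    u ^ (h+1) - v ^ (h+1) ≤ (h+1) * u ^ h * (u - v) := by
  induction h with
  | zero => simp
  | succ n ih =>
    have h1 : v ^ (n+1) ≤ u ^ (n+1) := pow_le_pow_left₀ hv huv _
    have e : u ^ (n+1+1) - v ^ (n+1+1) = u * (u ^ (n+1) - v ^ (n+1)) + v^(n+1) * (u - v) := by ring
    rw [e]
    have h2 : v^(n+1) * (u - v) ≤ u^(n+1) * (u-v) :=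
      mul_le_mul_of_nonneg_right h1 (by linarith)
    have h3 : u * (u ^ (n+1) - v ^ (n+1)) ≤ u * ((n+1) * u ^ n * (u - v)) :=
      mul_le_mul_of_nonneg_left ih (by linarith)
    push_cast
    have : u * ((n+1) * u ^ n * (u - v)) + u^(n+1) * (u-v) = ((n:ℝ) + 1 + 1) * u ^ (n + 1) * (u - v) := by
      ring
    linarith

lemma le_pow_diff (h : ℕ) (u v : ℝ) (hv : 0 ≤ v) (huv : v ≤ u) :
    u ^ h * (u - v) ≤ u ^ (h+1) - v ^ (h+1) := by
  have h1 : v ^ h ≤ u ^ h := pow_le_pow_left₀ hv huv _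
  have := mul_le_mul_of_nonneg_right h1 hv
  rw [pow_succ, pow_succ]
  linarith

lemma rt_incr_le (h : ℕ) (hh : 2 ≤ h) (n : ℕ) : rt h (n+1) * (rt h (n+1) - rt h n) ≤ 1 := by
  obtain ⟨t, rfl⟩ : ∃ t, h = t + 1 := ⟨h-1, by omega⟩
  have h1 := le_pow_diff t (rt (t+1) (n+1)) (rt (t+1) n) (rt_nonneg _ _) (rt_mono _ (by omega))
  rw [rt_pow _ _ hh, rt_pow _ _ hh] at h1
  push_cast at h1
  have h2 : rt (t+1) (n+1) ≤ rt (t+1) (n+1) ^ t := le_self_pow₀ (rt_one_le _ _ (by omega)) (by omega)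
  have h3 : 0 ≤ rt (t+1) (n+1) - rt (t+1) n := sub_nonneg.2 (rt_mono _ (by omega))
  have := mul_le_mul_of_nonneg_right h2 h3
  linarith

lemma le_rt_incr (t : ℕ) (hh : 1 ≤ t) (n : ℕ) :
    1 ≤ (t+1) * rt (t+1) (n+1) ^ t * (rt (t+1) (n+1) - rt (t+1) n) := by
  have h1 := pow_diff_le t (rt (t+1) (n+1)) (rt (t+1) n) (rt_nonneg _ _) (rt_mono _ (by omega))
  rw [rt_pow _ _ (by omega), rt_pow _ _ (by omega)] at h1
  push_cast at h1
  linarith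

open Classical in
/-- Counting function of a set. -/
noncomputable def cnt (S : Set ℕ) (x : ℕ) : ℕ := Nat.count (fun n => n ∈ S) x

open Classical in
lemma cnt_succ (S : Set ℕ) (x : ℕ) : cnt S (x+1) = cnt S x + if x ∈ S then 1 else 0 := by
  unfold cnt; rw [Nat.count_succ]

lemma cnt_mono (S : Set ℕ) {x y : ℕ} (hxy : x ≤ y) : cnt S x ≤ cnt S y := by
  classical
  exact Nat.count_monotone _ hxy

/-- Window condition. -/
def Win (h : ℕ) (S : Set ℕ) (c : ℝ) : Prop :=
  ∀ ε : ℝ, 0 < ε → ∀ᶠ y in atTop, ∀ x ≤ y,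
    (cnt S y : ℝ) - cnt S x ≤ c * (rt h y - rt h x) + ε * rt h y

lemma cnt_diff_mono {S R : Set ℕ} (hSR : S ⊆ R) {x y : ℕ} (hxy : x ≤ y) :
    (cnt S y : ℝ) - cnt S x ≤ (cnt R y : ℝ) - cnt R x := by
  induction y, hxy using Nat.le_induction with
  | base => simp
  | succ y _ ih =>
    rw [cnt_succ, cnt_succ]
    by_cases h1 : y ∈ S
    · have h2 := hSR h1
      simp only [h1, h2, if_true]; push_cast; linarith
    · by_cases h2 : y ∈ R
      · simp only [h1, h2, if_true, if_false]; push_cast; linarith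
      · simp only [h1, h2, if_false]; push_cast; linarith

lemma Win.mono {h : ℕ} {S R : Set ℕ} {c : ℝ} (hSR : S ⊆ R) (hR : Win h R c) : Win h S c := by
  intro ε hε
  filter_upwards [hR ε hε] with y hy x hxy
  exact (cnt_diff_mono hSR hxy).trans (hy x hxy)

open Classical in
/-- Greedy counting function. -/
noncomputable def gK (h : ℕ) (S : Set ℕ) (g : ℝ) : ℕ → ℕ
  | 0 => 0
  | n+1 => gK h S g n + if (n ∈ S ∨ n = 0 ∨ (gK h S g n : ℝ) < g * rt h n) then 1 else 0

/-- Greedy set. -/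
def gA (h : ℕ) (S : Set ℕ) (g : ℝ) : Set ℕ :=
  {n | n ∈ S ∨ n = 0 ∨ (gK h S g n : ℝ) < g * rt h n}

lemma cnt_gA (h : ℕ) (S : Set ℕ) (g : ℝ) (n : ℕ) : cnt (gA h S g) n = gK h S g n := by
  induction n with
  | zero => simp [cnt, gK]
  | succ n ih =>
    rw [cnt_succ, ih, gK]
    by_cases hc : n ∈ gA h S g
    · have hc' : n ∈ S ∨ n = 0 ∨ (gK h S g n : ℝ) < g * rt h n := hc
      rw [if_pos hc, if_pos hc']
    · have hc' : ¬ (n ∈ S ∨ n = 0 ∨ (gK h S g n : ℝ) < g * rt h n) := hc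
      rw [if_neg hc, if_neg hc']

lemma gK_lower (h : ℕ) (hh : 2 ≤ h) (S : Set ℕ) (g : ℝ) (hg : 0 < g) :
    ∃ B : ℝ, ∀ᶠ n in atTop, g * rt h n ≤ gK h S g n + B := by
  obtain ⟨n0, hn0⟩ := ((rt_tendsto h hh).eventually_ge_atTop g).exists_forall_of_atTop
  have hinc : ∀ n ≥ n0, g * rt h (n+1) ≤ g * rt h n + 1 := by
    intro n hn
    have h1 := rt_incr_le h hh n
    have h2 := hn0 (n+1) (by omega)
    have h3 : 0 ≤ rt h (n+1) - rt h n := sub_nonneg.2 (rt_mono _ (by omega))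
    have := mul_le_mul_of_nonneg_right h2 h3
    linarith
  refine ⟨g * rt h n0 + 1, ?_⟩
  filter_upwards [eventually_ge_atTop n0] with n hn
  have hpos : 0 ≤ g * rt h n0 := mul_nonneg hg.le (rt_nonneg _ _)
  induction n, hn using Nat.le_induction with
  | base =>
    have : (0:ℝ) ≤ gK h S g n0 := Nat.cast_nonneg _
    linarith
  | succ n hn ih =>
    have := hinc n hn
    rw [gK]
    by_cases hc : (gK h S g n : ℝ) < g * rt h n
    · simp only [hc, or_true, if_true]; push_cast; linarith
    · split_ifs <;> push_cast <;> linarith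

lemma gK_upper (h : ℕ) (S : Set ℕ) (g : ℝ) (hg : 0 < g) (n : ℕ) :
    ∃ m ≤ n, (gK h S g n : ℝ) ≤ g * rt h m + 1 + ((cnt S n : ℝ) - cnt S m) := by
  induction n with
  | zero =>
    refine ⟨0, le_rfl, ?_⟩
    have := mul_nonneg hg.le (rt_nonneg h 0)
    simp only [gK]; push_cast; linarith
  | succ n ih =>
    obtain ⟨m, hm, hK⟩ := ih
    by_cases h1 : n ∈ S
    · refine ⟨m, by omega, ?_⟩
      rw [gK, cnt_succ]
      simp only [h1, true_or, if_true]; push_cast; linarith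
    · by_cases h2 : n = 0 ∨ (gK h S g n : ℝ) < g * rt h n
      · refine ⟨n+1, le_rfl, ?_⟩
        have h3 : (gK h S g n : ℝ) ≤ g * rt h n := by
          rcases h2 with h2 | h2
          · subst h2; simpa [gK] using mul_nonneg hg.le (rt_nonneg h 0)
          · exact h2.le
        have h4 : g * rt h n ≤ g * rt h (n+1) := mul_le_mul_of_nonneg_left (rt_mono h (by omega)) hg.le
        rw [gK]
        simp only [h2, or_true, if_true]; push_cast; linarith
      · refine ⟨m, by omega, ?_⟩
        rw [gK, cnt_succ]
        simp only [h1, h2, false_or, if_false]; push_cast; linarith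

lemma gK_tendsto (h : ℕ) (hh : 2 ≤ h) (S : Set ℕ) (g c : ℝ) (hg : 0 < g) (hcg : c ≤ g)
    (hW : Win h S c) : Tendsto (fun n => (gK h S g n : ℝ) / rt h n) atTop (nhds g) := by
  rw [Metric.tendsto_atTop']
  intro ε hε
  obtain ⟨B, hB⟩ := gK_lower h hh S g hg
  have h1 := (rt_tendsto h hh).eventually_gt_atTop (max 0 (max (B/ε) (2/ε)))
  have := hB.and (h1.and (hW (ε/2) (by positivity)))
  obtain ⟨N, hN⟩ := this.exists_forall_of_atTop
  refine ⟨N, fun n hn => ?_⟩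
  obtain ⟨hl, hr, hw⟩ := hN n hn.le
  have hr0 : 0 < rt h n := lt_of_le_of_lt (le_max_left _ _) hr
  have hr1 : B < ε * rt h n := by
    have : B/ε < rt h n := lt_of_le_of_lt ((le_max_left _ _).trans (le_max_right _ _)) hr
    rw [div_lt_iff₀ hε] at this; linarith
  have hr2 : 2 < ε * rt h n := by
    have : 2/ε < rt h n := lt_of_le_of_lt ((le_max_right _ _).trans (le_max_right _ _)) hr
    rw [div_lt_iff₀ hε] at this; linarith
  obtain ⟨m, hm, hK⟩ := gK_upper h S g hg n
  have hw' := hw m hm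
  have h5 : c * (rt h n - rt h m) ≤ g * (rt h n - rt h m) :=
    mul_le_mul_of_nonneg_right hcg (sub_nonneg.2 (rt_mono h hm))
  rw [Real.dist_eq, abs_lt]
  constructor
  · rw [lt_sub_iff_add_lt, lt_div_iff₀ hr0]; linarith
  · rw [sub_lt_iff_lt_add, div_lt_iff₀ hr0]; linarith

lemma hsum_mono (h : ℕ) {S R : Set ℕ} (hSR : S ⊆ R) : hsumSet h S ⊆ hsumSet h R := by
  rintro n ⟨f, hf, hs⟩
  exact ⟨f, fun i => hSR (hf i), hs⟩

lemma fill (h : ℕ) (hh : 2 ≤ h) (S : Set ℕ) (g c : ℝ) (hg : 0 < g) (hcg : c ≤ g)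
    (hW : Win h S c) (h0 : 0 ∉ S) (hb : {n : ℕ | n ∉ hsumSet h S}.Finite) :
    IsAdditiveEigenvalue h ((g ^ h)⁻¹) := by
  classical
  have hT := gK_tendsto h hh S g c hg hcg hW
  set A := gA h S g with hA
  have hinf : (Set.ofPred (fun n => n ∈ A)).Infinite := by
    intro hfin
    obtain ⟨B, hB⟩ := gK_lower h hh S g hg
    have h1 := (rt_tendsto h hh).eventually_gt_atTop ((hfin.toFinset.card + B)/g)
    obtain ⟨n, hn1, hn2⟩ := (hB.and h1).exists
    have h2 : gK h S g n ≤ hfin.toFinset.card := by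
      rw [← cnt_gA]
      exact Nat.count_le_card hfin n
    have h3 : (gK h S g n : ℝ) ≤ hfin.toFinset.card := by exact_mod_cast h2
    rw [div_lt_iff₀ hg] at hn2
    linarith
  let a : ℕ → ℕ := Nat.nth (fun n => n ∈ A)
  have ha : StrictMono a := Nat.nth_strictMono hinf
  have h0A : (0:ℕ) ∈ A := by right; left; rfl
  have ha0 : a 0 = 0 := Nat.nth_zero_of_zero h0A
  have hrange : Set.range a = A := Nat.range_nth_of_infinite hinf
  refine ⟨by positivity, a, ha, ?_, ?_⟩
  · apply hb.subset
    intro n hn hn2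
    apply hn
    apply hsum_mono h _ hn2
    intro s hs
    have : s ∈ Set.range a := by rw [hrange]; left; exact hs
    obtain ⟨k, rfl⟩ := this
    refine ⟨k, ?_, rfl⟩
    rw [Set.mem_Ici]
    rcases Nat.eq_zero_or_pos k with hk | hk
    · subst hk; rw [ha0] at hs; exact absurd hs h0
    · exact hk
  · have h1 := hT.comp ha.tendsto_atTop
    have hc : ∀ n, gK h S g (a n) = n := by
      intro n
      rw [← cnt_gA]
      exact Nat.count_nth_of_infinite hinf n
    have h2 := (h1.pow h).inv₀ (by positivity)
    have h3 := h2.mul_const (g^h)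
    rw [inv_mul_cancel₀ (by positivity)] at h3
    refine h3.congr (fun n => ?_)
    simp only [Function.comp, hc]
    rw [div_pow, rt_pow _ _ hh, inv_div]
    rw [div_mul_eq_mul_div, mul_comm ((g^h)⁻¹), div_mul_eq_div_div, div_inv_eq_mul]
    ring

lemma eig_le_one (h : ℕ) (hh : 2 ≤ h) (lam : ℝ) (hl : IsAdditiveEigenvalue h lam) : lam ≤ 1 := by
  classical
  obtain ⟨hpos, a, ha, hfin, hT⟩ := hl
  obtain ⟨N0, hN0⟩ := hfin.bddAbove
  have key : ∀ n, a n ≤ n ^ h + (N0 + 1) := by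
    intro n
    have hsub : Finset.Ico (N0+1) (a n) ⊆
        Finset.image (fun f : Fin h → Fin n => ∑ i, a (f i)) Finset.univ := by
      intro m hm
      rw [Finset.mem_Ico] at hm
      have hm1 : m ∈ hsumSet h (a '' Set.Ici 1) := by
        by_contra hcon
        have := hN0 (show m ∈ {n : ℕ | n ∉ hsumSet h (a '' Set.Ici 1)} from hcon)
        omega
      obtain ⟨f, hf, hs⟩ := hm1
      choose k hk1 hk2 using hf
      have hkn : ∀ i, k i < n := by
        intro i
        rw [← ha.lt_iff_lt, hk2]
        have : f i ≤ ∑ i, f i := Finset.single_le_sum (fun _ _ => Nat.zero_le _) (Finset.mem_univ i)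
        omega
      rw [Finset.mem_image]
      refine ⟨fun i => ⟨k i, hkn i⟩, Finset.mem_univ _, ?_⟩
      simp only [hk2, hs]
    have h1 := (Finset.card_le_card hsub).trans Finset.card_image_le
    simp at h1
    omega
  have h1 : Tendsto (fun n : ℕ => 1 / lam + ((N0 + 1 : ℝ) / lam) * ((n:ℝ) ^ h)⁻¹) atTop
      (nhds (1 / lam + ((N0 + 1 : ℝ) / lam) * 0)) := by
    apply Tendsto.const_add
    apply Tendsto.const_mul
    apply Tendsto.inv_tendsto_atTop
    exact (tendsto_pow_atTop (by omega : h ≠ 0)).comp tendsto_natCast_atTop_atTop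
  have h2 : (1:ℝ) ≤ 1 / lam + ((N0 + 1 : ℝ) / lam) * 0 := by
    apply le_of_tendsto_of_tendsto hT h1
    filter_upwards [eventually_ge_atTop 1] with n hn
    have hn' : (0:ℝ) < (n:ℝ) ^ h := by
      have : (0:ℝ) < n := by exact_mod_cast hn
      positivity
    have hk : (a n : ℝ) ≤ (n:ℝ) ^ h + (N0 + 1) := by exact_mod_cast key n
    have e : 1 / lam + ((N0 + 1 : ℝ) / lam) * ((n:ℝ) ^ h)⁻¹ = ((n:ℝ) ^ h + (N0 + 1)) / (lam * (n:ℝ)^h) := by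
      field_simp
    rw [e]
    gcongr
  rw [mul_zero, add_zero, le_div_iff₀ hpos] at h2
  linarith

lemma cnt_range (a : ℕ → ℕ) (ha : StrictMono a) (n : ℕ) : cnt (Set.range a) (a n) = n := by
  classical
  unfold cnt
  rw [Nat.count_eq_card_filter_range]
  have : (Finset.range (a n)).filter (fun x => x ∈ Set.range a) = (Finset.range n).image a := by
    ext x
    simp only [Finset.mem_filter, Finset.mem_range, Set.mem_range, Finset.mem_image]
    constructor
    · rintro ⟨h1, k, rfl⟩
      exact ⟨k, ha.lt_iff_lt.1 h1, rfl⟩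
    · rintro ⟨k, hk, rfl⟩
      exact ⟨ha hk, k, rfl⟩
  rw [this, Finset.card_image_of_injective _ ha.injective, Finset.card_range]

lemma range_win (h : ℕ) (hh : 2 ≤ h) (lam : ℝ) (hpos : 0 < lam) (a : ℕ → ℕ) (ha : StrictMono a)
    (hT : Tendsto (fun n : ℕ => (a n : ℝ) / (lam * (n : ℝ) ^ h)) atTop (nhds 1)) :
    Win h (Set.range a) ((lam ^ ((h:ℝ)⁻¹))⁻¹) := by
  have hh0 : (0:ℝ) < (h:ℝ)⁻¹ := by
    have : (0:ℝ) < h := by exact_mod_cast (by omega : 0 < h)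
    positivity
  set l := lam ^ ((h:ℝ)⁻¹) with hl
  have hl0 : 0 < l := Real.rpow_pos_of_pos hpos _
  set c := l⁻¹ with hc
  have hc0 : 0 < c := by positivity
  -- the limit of n / rt (a n)
  have hlim : Tendsto (fun n : ℕ => (n:ℝ) / rt h (a n)) atTop (nhds c) := by
    have h1 := (hT.rpow_const (p := (h:ℝ)⁻¹) (Or.inl one_ne_zero))
    rw [Real.one_rpow] at h1
    have h2 := (h1.inv₀ one_ne_zero).mul_const c
    rw [inv_one, one_mul] at h2
    refine h2.congr (fun n => ?_)
    rw [Real.div_rpow (by positivity) (by positivity), Real.mul_rpow (by positivity) (by positivity),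
      Real.pow_rpow_inv_natCast (by positivity) (by omega), ← hl, inv_div]
    change l * n / rt h (a n) * c = _
    rw [hc]; field_simp
  have hK1 : ∀ x, x ≤ a (cnt (Set.range a) x) := by
    intro x
    by_contra hcon
    push Not at hcon
    have h1 := cnt_mono (Set.range a) (Nat.succ_le_of_lt hcon)
    rw [Nat.succ_eq_add_one, cnt_succ, cnt_range a ha, if_pos ⟨_, rfl⟩] at h1
    omega
  have hK2 : ∀ x m, cnt (Set.range a) x = m + 1 → a m < x := by
    intro x m hm
    by_contra hcon
    push Not at hcon
    have h1 := cnt_mono (Set.range a) hcon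
    rw [cnt_range a ha] at h1
    omega
  -- asymptotic two-sided bound
  have hasym : ∀ ε : ℝ, 0 < ε → ∀ᶠ x in atTop,
      c * rt h x - ε * rt h x ≤ cnt (Set.range a) x ∧
      (cnt (Set.range a) x : ℝ) ≤ c * rt h x + ε * rt h x + 1 := by
    intro ε hε
    have h1 := hlim.eventually (Ioo_mem_nhds (show c - ε < c by linarith) (show c < c + ε by linarith))
    obtain ⟨N, hN⟩ := (h1.and (eventually_ge_atTop 1)).exists_forall_of_atTop
    filter_upwards [eventually_gt_atTop (a N)] with x hx
    obtain ⟨m, hm⟩ : ∃ m, cnt (Set.range a) x = m + 1 := by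
      have := (ha.lt_iff_lt.1 (lt_of_lt_of_le hx (hK1 x)))
      exact ⟨cnt (Set.range a) x - 1, by omega⟩
    have hNm : N ≤ m := by
      have := (ha.lt_iff_lt.1 (lt_of_lt_of_le hx (hK1 x)))
      omega
    have hx1 := hK1 x
    have hx2 := hK2 x m hm
    rw [hm] at hx1 ⊢
    obtain ⟨⟨_, hu⟩, hm1⟩ := hN m hNm
    obtain ⟨⟨hd, _⟩, _⟩ := hN (m+1) (by omega)
    have p1 : 0 < rt h (a m) := lt_of_lt_of_le one_pos
      (rt_one_le h _ (hm1.trans ha.le_apply))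
    have p2 : 0 < rt h (a (m+1)) := lt_of_lt_of_le p1 (rt_mono h (ha (by omega : m < m+1)).le)
    rw [div_lt_iff₀ p1] at hu
    rw [lt_div_iff₀ p2] at hd
    have r1 := rt_mono h hx2.le
    have r2 := rt_mono h hx1
    constructor
    · by_cases hce : 0 ≤ c - ε
      · have := mul_le_mul_of_nonneg_left r2 hce
        linarith
      · have h3 : (c - ε) * rt h x ≤ 0 := mul_nonpos_of_nonpos_of_nonneg (by linarith) (rt_nonneg _ _)
        have : (0:ℝ) ≤ ((m+1 : ℕ) : ℝ) := Nat.cast_nonneg _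
        linarith
    · have := mul_le_mul_of_nonneg_left r1 (by linarith : 0 ≤ c + ε)
      push_cast
      linarith
  intro ε hε
  obtain ⟨N, hN⟩ := (hasym (ε/3) (by positivity)).exists_forall_of_atTop
  have h1 := (rt_tendsto h hh).eventually_gt_atTop ((c * rt h N + 1)/(ε/3))
  filter_upwards [eventually_ge_atTop N, h1] with y hyN hy x hxy
  rw [div_lt_iff₀ (by positivity)] at hy
  have hy2 := (hN y hyN).2
  have hx0 := rt_nonneg h x
  have hN0 := mul_nonneg hc0.le (rt_nonneg h N)
  by_cases hxN : N ≤ x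
  · have hx1 := (hN x hxN).1
    have : ε / 3 * rt h x ≤ ε / 3 * rt h y := mul_le_mul_of_nonneg_left (rt_mono h hxy) (by positivity)
    linarith
  · have hx1 : c * rt h x ≤ c * rt h N := mul_le_mul_of_nonneg_left (rt_mono h (by omega)) hc0.le
    have : (0:ℝ) ≤ cnt (Set.range a) x := Nat.cast_nonneg _
    have : 0 ≤ ε / 3 * rt h y := mul_nonneg (by positivity) (rt_nonneg _ _)
    linarith

lemma eig_down (h : ℕ) (hh : 2 ≤ h) (lam mu : ℝ) (hl : IsAdditiveEigenvalue h lam)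
    (hmu : 0 < mu) (hml : mu < lam) : IsAdditiveEigenvalue h mu := by
  obtain ⟨hpos, a, ha, hfin, hT⟩ := hl
  have hW := range_win h hh lam hpos a ha hT
  have hm0 : 0 < mu ^ ((h:ℝ)⁻¹) := Real.rpow_pos_of_pos hmu _
  have := fill h hh (a '' Set.Ici 1) ((mu ^ ((h:ℝ)⁻¹))⁻¹) ((lam ^ ((h:ℝ)⁻¹))⁻¹) (by positivity)
    (inv_anti₀ hm0 (Real.rpow_le_rpow hmu.le hml.le (by positivity)))
    (hW.mono (Set.image_subset_range _ _)) ?_ hfin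
  · rwa [inv_pow, Real.rpow_inv_natCast_pow hmu.le (by omega), inv_inv] at this
  · rintro ⟨k, hk, hk0⟩
    have : a 0 < a k := ha (Nat.lt_of_lt_of_le Nat.zero_lt_one hk)
    omega

/-- Common differences of the progressions in the construction. -/
def cD (t k i : ℕ) : ℕ := if i < t then 2 ^ (k*i) + 2 ^ (k*t) else 2 ^ (k*t)

/-- The explicit thin basis. -/
def cS (t C : ℕ) : Set ℕ :=
  {n | ∃ k, ∃ i < t+1, ∃ d ≤ C * 2^k, n = d * cD t k i + 2 ^ (k*(t+1))}

lemma cD_ge (t k i : ℕ) : 2 ^ (k*t) ≤ cD t k i := by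
  unfold cD
  split_ifs
  · exact Nat.le_add_left _ _
  · exact le_rfl

lemma cD_le (t k i : ℕ) : cD t k i ≤ 2 * 2 ^ (k*t) := by
  unfold cD
  split_ifs with h
  · have : 2 ^ (k*i) ≤ 2 ^ (k*t) := Nat.pow_le_pow_right (by norm_num) (Nat.mul_le_mul_left _ h.le)
    omega
  · omega

lemma digits_sum (q n t : ℕ) :
    ∑ i ∈ Finset.range t, (n / q^i % q) * q^i + (n / q^t) * q^t = n := by
  induction t with
  | zero => simp
  | succ t ih =>
    rw [Finset.sum_range_succ]
    have h1 : n / q^(t+1) = n / q^t / q := by rw [pow_succ, Nat.div_div_eq_div_mul]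
    rw [h1]
    have h2 := Nat.mod_add_div (n / q^t) q
    calc _ = ∑ i ∈ Finset.range t, (n / q^i % q) * q^i
          + ((n / q^t) % q + q * (n / q^t / q)) * q^t := by ring
      _ = n := by rw [h2, ih]

lemma cS_basis (t : ℕ) (ht : 1 ≤ t) :
    {n : ℕ | n ∉ hsumSet (t+1) (cS t (2*(t+1)*2^(t+1)))}.Finite := by
  apply (Set.finite_Iio (2*(t+1))).subset
  intro n hn
  rw [Set.mem_Iio]
  by_contra hge
  push Not at hge
  apply hn
  set C := 2*(t+1)*2^(t+1) with hC
  set k := Nat.log (2^(t+1)) (n / (2*(t+1))) with hk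
  have hdiv : n / (2*(t+1)) ≠ 0 := (Nat.div_pos hge (by omega)).ne'
  have hb : 1 < 2^(t+1) := Nat.one_lt_two_pow (by omega)
  have h1 : (2^(t+1))^k ≤ n / (2*(t+1)) := Nat.pow_log_le_self _ hdiv
  have h2 : n / (2*(t+1)) < (2^(t+1))^(k+1) := Nat.lt_pow_succ_log_self hb _
  rw [Nat.le_div_iff_mul_le (by omega)] at h1
  rw [Nat.div_lt_iff_lt_mul (by omega)] at h2
  set q := 2^k with hq
  have hq0 : 0 < q := by positivity
  have e1 : (2^(t+1))^k = q^t * q := by rw [← pow_mul, mul_comm, pow_mul, pow_succ]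
  have e2 : (2^(t+1))^(k+1) = q^t * q * 2^(t+1) := by rw [pow_succ, e1]
  have e3 : 2 ^ (k*(t+1)) = q^t * q := by rw [pow_mul, pow_succ]
  rw [e1] at h1
  rw [e2] at h2
  set X := q^t * q with hX
  obtain ⟨n', hn'⟩ : ∃ n', n = n' + (t+1) * X := ⟨n - (t+1)*X, by
    have : (t+1) * X ≤ X * (2*(t+1)) := by nlinarith
    omega⟩
  have hn1 : (t+1) * X ≤ n' := by nlinarith
  have hn2 : n' ≤ C * X := by rw [hC]; nlinarith
  have hds := digits_sum q n' t
  set e := n' / q^t with he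
  have hqt : 0 < q^t := by positivity
  have he1 : (t+1) * q ≤ e := by
    rw [he, Nat.le_div_iff_mul_le hqt]
    calc _ = (t+1)*X := by rw [hX]; ring
      _ ≤ _ := hn1
  have he2 : e ≤ C * q := by
    rw [he]
    apply Nat.div_le_of_le_mul
    calc _ ≤ C * X := hn2
      _ = _ := by rw [hX]; ring
  set d : ℕ → ℕ := fun i => n' / q^i % q with hd
  have hdq : ∀ i, d i < q := fun i => Nat.mod_lt _ hq0
  have hsd : ∑ i ∈ Finset.range t, d i ≤ e := by
    calc _ ≤ ∑ i ∈ Finset.range t, q := Finset.sum_le_sum (fun i _ => (hdq i).le)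
      _ = t * q := by simp
      _ ≤ e := by nlinarith
  obtain ⟨r, hr⟩ := Nat.exists_eq_add_of_le hsd
  let F : ℕ → ℕ := fun i => (if i < t then d i else r) * cD t k i + 2 ^ (k*(t+1))
  refine ⟨fun i => F i, ?_, ?_⟩
  · intro i
    refine ⟨k, i, i.2, (if (i:ℕ) < t then d i else r), ?_, rfl⟩
    split_ifs
    · have := hdq i
      have : 1 ≤ C := by rw [hC]; exact Nat.succ_le_of_lt (by positivity)
      nlinarith
    · exact le_trans (by omega) he2
  · rw [Fin.sum_univ_eq_sum_range F (t+1), Finset.sum_range_succ]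
    have hF1 : ∀ i ∈ Finset.range t, F i = d i * q^i + d i * q^t + X := by
      intro i hi
      rw [Finset.mem_range] at hi
      simp only [F, cD, if_pos hi, e3]
      rw [pow_mul, pow_mul]; ring
    have hF2 : F t = r * q^t + X := by
      simp only [F, cD, lt_irrefl, if_false, e3]
      rw [pow_mul]
    rw [Finset.sum_congr rfl hF1, hF2, Finset.sum_add_distrib, Finset.sum_add_distrib,
      ← Finset.sum_mul]
    simp only [Finset.sum_const, Finset.card_range, smul_eq_mul]
    rw [hr] at hds
    rw [hn']
    change ∑ i ∈ Finset.range t, d i * q^i + _ = n' at hds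
    rw [add_mul] at hds
    linarith

lemma geom_tail (T : ℝ) (hT : 0 < T) (L : ℕ) :
    ∑ k ∈ Finset.range L, (if T ≤ 2^k then ((2:ℝ)^k)⁻¹ else 0) ≤ 2 / T := by
  have key : ∀ L : ℕ, (T ≤ 2^L → ∑ k ∈ Finset.range L, (if T ≤ 2^k then ((2:ℝ)^k)⁻¹ else 0)
      + 2 * ((2:ℝ)^L)⁻¹ ≤ 2 / T) ∧
      (¬ T ≤ 2^L → ∑ k ∈ Finset.range L, (if T ≤ 2^k then ((2:ℝ)^k)⁻¹ else 0) = 0) := by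
    intro L
    induction L with
    | zero =>
      refine ⟨fun h => ?_, fun _ => by simp⟩
      simp only [pow_zero] at h
      simp only [Finset.range_zero, Finset.sum_empty, pow_zero, inv_one, mul_one, zero_add]
      rw [le_div_iff₀ hT]; linarith
    | succ L ih =>
      rw [Finset.sum_range_succ]
      have hp : (0:ℝ) < 2^L := by positivity
      have e : 2 * ((2:ℝ)^(L+1))⁻¹ = (2^L)⁻¹ := by rw [pow_succ]; field_simp
      rw [e]
      constructor
      · intro h
        by_cases h2 : T ≤ 2^L
        · rw [if_pos h2]
          have := ih.1 h2
          linarith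
        · rw [if_neg h2, ih.2 h2]
          rw [zero_add, zero_add, inv_eq_one_div, div_le_div_iff₀ hp hT]
          rw [pow_succ] at h
          linarith
      · intro h
        have h2 : ¬ T ≤ 2^L := by
          intro h2; apply h; rw [pow_succ]; linarith
        rw [if_neg h2, ih.2 h2, add_zero]
  by_cases h : T ≤ 2^L
  · have := (key L).1 h
    have : 0 < 2 * ((2:ℝ)^L)⁻¹ := by positivity
    linarith
  · rw [(key L).2 h]; positivity

lemma ap_count (x z D v : ℕ) (hD : 0 < D) :
    (((Finset.Ico x z).filter (fun n => n ≡ v [MOD D])).card : ℝ) ≤ ((Finset.Ico x z).card : ℝ) / D + 1 := by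
  rcases le_or_gt z x with hzx | hxz
  · rw [Finset.Ico_eq_empty_of_le hzx]; simp
  have h1 := Nat.Ico_filter_modEq_card x z hD v
  have hD' : (0:ℝ) < D := by exact_mod_cast hD
  have h2 : ((((Finset.Ico x z).filter (fun n => n ≡ v [MOD D])).card : ℤ) : ℚ) ≤ ((z:ℚ) - x) / D + 1 := by
    rw [h1]
    have a1 := Int.ceil_lt_add_one (((z:ℚ) - v) / D)
    have a2 := Int.le_ceil (((x:ℚ) - v) / D)
    have hzx : (0:ℚ) ≤ ((z:ℚ) - x) / D := by
      apply div_nonneg _ (by positivity)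
      have : (x:ℚ) ≤ z := by exact_mod_cast hxz.le
      linarith
    have e : ((z:ℚ) - x) / D = ((z:ℚ) - v)/D - ((x:ℚ) - v)/D := by ring
    push_cast
    apply max_le
    · rw [e]; linarith
    · linarith
  have h3 : (((Finset.Ico x z).filter (fun n => n ≡ v [MOD D])).card : ℝ) ≤ ((z:ℝ) - x) / D + 1 := by
    exact_mod_cast h2
  rw [Nat.card_Ico, Nat.cast_sub hxz.le]
  exact h3

lemma weight_le (t : ℕ) (ht : 1 ≤ t) (M : ℕ) (hM : 1 ≤ M) (L n : ℕ) :
    ∑ k ∈ Finset.range L, (if n + 1 ≤ M * 2^(k*(t+1)) then ((2:ℝ)^(k*t))⁻¹ else 0)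
      ≤ 2 * (M:ℝ)^t * (t+1) * (rt (t+1) (n+1) - rt (t+1) n) := by
  set u := rt (t+1) (n+1) with hu
  have hu1 : 1 ≤ u := rt_one_le _ _ (by omega)
  have hM' : (1:ℝ) ≤ M := by exact_mod_cast hM
  have hM0 : (0:ℝ) < M := by linarith
  set T := u / M with hT
  have hT0 : 0 < T := by positivity
  obtain ⟨s, rfl⟩ : ∃ s, t = s + 1 := ⟨t-1, by omega⟩
  have hterm : ∀ k, (if n + 1 ≤ M * 2^(k*(s+1+1)) then ((2:ℝ)^(k*(s+1)))⁻¹ else 0) ≤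
      (T^s)⁻¹ * (if T ≤ 2^k then ((2:ℝ)^k)⁻¹ else 0) := by
    intro k
    have h2k : (0:ℝ) < 2^k := by positivity
    by_cases h : n + 1 ≤ M * 2^(k*(s+1+1))
    · have hTk : T ≤ 2^k := by
        rw [hT, div_le_iff₀ hM0]
        apply le_of_pow_le_pow_left₀ (n := s+1+1) (by omega) (by positivity)
        rw [hu, rt_pow _ _ (by omega)]
        have h' : ((n+1 : ℕ) : ℝ) ≤ M * 2^(k*(s+1+1)) := by exact_mod_cast h
        rw [mul_pow, ← pow_mul]
        have : (M:ℝ) ≤ M^(s+1+1) := le_self_pow₀ hM' (by omega)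
        calc _ ≤ _ := h'
          _ ≤ M^(s+1+1) * 2^(k*(s+1+1)) := by gcongr
          _ = _ := by ring
      rw [if_pos h, if_pos hTk, pow_mul, pow_succ, mul_inv]
      gcongr
    · rw [if_neg h]
      split_ifs <;> positivity
  calc _ ≤ ∑ k ∈ Finset.range L, (T^s)⁻¹ * (if T ≤ 2^k then ((2:ℝ)^k)⁻¹ else 0) :=
        Finset.sum_le_sum (fun k _ => hterm k)
    _ = (T^s)⁻¹ * ∑ k ∈ Finset.range L, (if T ≤ 2^k then ((2:ℝ)^k)⁻¹ else 0) := by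
        rw [Finset.mul_sum]
    _ ≤ (T^s)⁻¹ * (2 / T) := by
        gcongr
        exact geom_tail T hT0 L
    _ = 2 * (M:ℝ)^(s+1) * (u^(s+1))⁻¹ := by
        rw [hT, div_pow]; field_simp; ring
    _ ≤ _ := by
        have h1 := le_rt_incr (s+1) ht n
        rw [← hu] at h1
        rw [mul_assoc (2 * (M:ℝ)^(s+1))]
        gcongr
        rw [inv_le_iff_one_le_mul₀ (by positivity)]
        calc _ ≤ _ := h1
          _ = _ := by ring

lemma cS_count (t C : ℕ) (ht : 1 ≤ t) (x y : ℕ) (hxy : x ≤ y) :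
    (cnt (cS t C) y : ℝ) - cnt (cS t C) x ≤
      (t+1) * (2 * ((2*C+2 : ℕ):ℝ)^t * (t+1)) * (rt (t+1) y - rt (t+1) x)
        + (t+1) * ((Nat.log 2 y : ℝ) + 1) := by
  classical
  set M := 2*C+2 with hM
  set L := Nat.log 2 y + 1 with hL
  set W := (Finset.Ico x y).filter (fun n => n ∈ cS t C) with hW
  have hc : (cnt (cS t C) y : ℝ) - cnt (cS t C) x = W.card := by
    rw [hW]
    clear hW W hL L
    induction y, hxy using Nat.le_induction with
    | base => simp
    | succ y hy ih =>
      rw [cnt_succ, ← Finset.insert_Ico_right_eq_Ico_add_one hy, Finset.filter_insert]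
      split_ifs with h
      · rw [Finset.card_insert_of_notMem (by simp)]
        push_cast; linarith
      · push_cast; linarith
  rw [hc]
  let G : ℕ → ℕ → Finset ℕ := fun k i =>
    (Finset.Ico x (min y (M * 2^(k*(t+1))))).filter (fun n => n ≡ 2^(k*(t+1)) [MOD cD t k i])
  have hsub : W ⊆ (Finset.range L).biUnion (fun k => (Finset.range (t+1)).biUnion (fun i => G k i)) := by
    intro n hn
    rw [hW, Finset.mem_filter, Finset.mem_Ico] at hn
    obtain ⟨⟨hn1, hn2⟩, k, i, hi, d, hd, hnd⟩ := hn
    have hX : 1 ≤ 2^(k*(t+1)) := Nat.one_le_two_pow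
    rw [Finset.mem_biUnion]
    refine ⟨k, ?_, ?_⟩
    · rw [Finset.mem_range, hL, Nat.lt_succ_iff]
      apply Nat.le_log_of_pow_le (by norm_num)
      have : 2^k ≤ 2^(k*(t+1)) := Nat.pow_le_pow_right (by norm_num) (Nat.le_mul_of_pos_right _ (by omega))
      have h3 : 2^(k*(t+1)) ≤ n := by rw [hnd]; exact Nat.le_add_left _ _
      omega
    · rw [Finset.mem_biUnion]
      refine ⟨i, Finset.mem_range.2 hi, ?_⟩
      simp only [G, Finset.mem_filter, Finset.mem_Ico, lt_min_iff]
      refine ⟨⟨hn1, hn2, ?_⟩, ?_⟩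
      · have h1 : d * cD t k i ≤ (C * 2^k) * (2 * 2^(k*t)) := Nat.mul_le_mul hd (cD_le t k i)
        have h2 : (C * 2^k) * (2 * 2^(k*t)) = 2 * C * 2^(k*(t+1)) := by
          rw [mul_add, pow_add, mul_one]; ring
        rw [hM, add_mul, hnd]
        omega
      · rw [hnd]
        simp
  have hG : ∀ k i, ((G k i).card : ℝ) ≤
      ∑ n ∈ Finset.Ico x y, (if n + 1 ≤ M * 2^(k*(t+1)) then ((2:ℝ)^(k*t))⁻¹ else 0) + 1 := by
    intro k i
    have hD := cD_ge t k i
    have hp : 0 < 2^(k*t) := by positivity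
    have h1 := ap_count x (min y (M * 2^(k*(t+1)))) (cD t k i) (2^(k*(t+1))) (by omega)
    refine h1.trans ?_
    have e : Finset.Ico x (min y (M * 2^(k*(t+1)))) =
        (Finset.Ico x y).filter (fun n => n + 1 ≤ M * 2^(k*(t+1))) := by
      ext n
      simp only [Finset.mem_Ico, Finset.mem_filter, lt_min_iff]
      tauto
    rw [e, ← Finset.sum_filter, Finset.sum_const, nsmul_eq_mul, ← div_eq_mul_inv]
    have hD' : (2:ℝ)^(k*t) ≤ cD t k i := by exact_mod_cast hD
    gcongr
  have hcard : (W.card : ℝ) ≤ ∑ k ∈ Finset.range L, ∑ i ∈ Finset.range (t+1), ((G k i).card : ℝ) := by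
    have h1 := (Finset.card_le_card hsub).trans Finset.card_biUnion_le
    have h2 : W.card ≤ ∑ k ∈ Finset.range L, ∑ i ∈ Finset.range (t+1), (G k i).card :=
      h1.trans (Finset.sum_le_sum (fun k _ => Finset.card_biUnion_le))
    exact_mod_cast h2
  refine hcard.trans ?_
  calc _ ≤ ∑ k ∈ Finset.range L, ∑ i ∈ Finset.range (t+1),
        (∑ n ∈ Finset.Ico x y, (if n + 1 ≤ M * 2^(k*(t+1)) then ((2:ℝ)^(k*t))⁻¹ else 0) + 1) :=
        Finset.sum_le_sum (fun k _ => Finset.sum_le_sum (fun i _ => hG k i))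
    _ = (t+1) * ∑ n ∈ Finset.Ico x y, ∑ k ∈ Finset.range L,
          (if n + 1 ≤ M * 2^(k*(t+1)) then ((2:ℝ)^(k*t))⁻¹ else 0) + (t+1) * L := by
        rw [Finset.sum_comm (s := Finset.Ico x y)]
        simp only [Finset.sum_const, Finset.card_range, nsmul_eq_mul]
        rw [← Finset.mul_sum, Finset.sum_add_distrib]
        simp only [Finset.sum_const, Finset.card_range, nsmul_eq_mul]
        push_cast; ring
    _ ≤ (t+1) * ∑ n ∈ Finset.Ico x y, 2 * (M:ℝ)^t * (t+1) * (rt (t+1) (n+1) - rt (t+1) n)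
          + (t+1) * L := by
        gcongr with n hn
        exact weight_le t ht M (by omega) L n
    _ = _ := by
        rw [← Finset.mul_sum, Finset.sum_Ico_sub (rt (t+1)) hxy, hL]
        push_cast; ring

lemma log_small (h : ℕ) (hh : 2 ≤ h) (ε : ℝ) (hε : 0 < ε) :
    ∀ᶠ y : ℕ in atTop, (Nat.log 2 y : ℝ) + 1 ≤ ε * rt h y := by
  have hh0 : (0:ℝ) < (h:ℝ)⁻¹ := by
    have : (0:ℝ) < h := by exact_mod_cast (by omega : 0 < h)
    positivity
  have hl2 : 0 < Real.log 2 := Real.log_pos (by norm_num)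
  have h1 := (isLittleO_log_rpow_atTop hh0).def (c := ε / 2 * Real.log 2) (by positivity)
  have h2 := tendsto_natCast_atTop_atTop (R := ℝ) |>.eventually h1
  have h3 := (rt_tendsto h hh).eventually_gt_atTop (2/ε)
  filter_upwards [h2, h3] with y hy hy2
  have h4 : Real.log y ≤ ε / 2 * Real.log 2 * rt h y := by
    have := (le_abs_self _).trans hy
    rwa [Real.norm_of_nonneg (Real.rpow_nonneg (Nat.cast_nonneg y) _)] at this
  have h5 := Real.natLog_le_logb y 2
  rw [Real.logb] at h5
  have h6 : Real.log y / Real.log ((2:ℕ):ℝ) ≤ ε / 2 * rt h y := by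
    push_cast
    rw [div_le_iff₀ hl2]; linarith
  rw [div_lt_iff₀ hε] at hy2
  linarith

lemma eig_exists (h : ℕ) (hh : 2 ≤ h) : ∃ lam, IsAdditiveEigenvalue h lam := by
  obtain ⟨t, rfl⟩ : ∃ t, h = t + 1 := ⟨h-1, by omega⟩
  set C := 2*(t+1)*2^(t+1) with hC
  set c : ℝ := (t+1) * (2 * ((2*C+2 : ℕ):ℝ)^t * (t+1)) with hc
  have hc0 : 0 < c := by positivity
  refine ⟨_, fill (t+1) hh (cS t C) c c hc0 le_rfl ?_ ?_ (cS_basis t (by omega))⟩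
  · intro ε hε
    filter_upwards [log_small (t+1) hh (ε / (t+1)) (by positivity)] with y hy x hxy
    refine (cS_count t C (by omega) x y hxy).trans ?_
    rw [← hc]
    have ht : (0:ℝ) < t + 1 := by positivity
    have := mul_le_mul_of_nonneg_left hy ht.le
    have e : ((t:ℝ)+1) * (ε / (t+1) * rt (t+1) y) = ε * rt (t+1) y := by field_simp
    linarith
  · rintro ⟨k, i, _, d, _, h0⟩
    have : 0 < 2^(k*(t+1)) := by positivity
    omega

/-- Nathanson: for every `h ≥ 2` the additive spectrum `Λ_h` is an interval
`(0, λ*_h)` or `(0, λ*_h]`. -/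
theorem stmt12 (h : ℕ) (hh : 2 ≤ h) :
    ∃ lam : ℝ, 0 < lam ∧
      Set.Ioo (0 : ℝ) lam ⊆ {x : ℝ | IsAdditiveEigenvalue h x} ∧
      {x : ℝ | IsAdditiveEigenvalue h x} ⊆ Set.Ioc (0 : ℝ) lam := by
  obtain ⟨l0, hl0⟩ := eig_exists h hh
  have hbdd : BddAbove {x : ℝ | IsAdditiveEigenvalue h x} := ⟨1, fun x hx => eig_le_one h hh x hx⟩
  refine ⟨sSup {x : ℝ | IsAdditiveEigenvalue h x}, lt_of_lt_of_le hl0.1 (le_csSup hbdd hl0), ?_, ?_⟩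
  · rintro x ⟨hx0, hx1⟩
    obtain ⟨y, hy, hxy⟩ := exists_lt_of_lt_csSup ⟨l0, hl0⟩ hx1
    exact eig_down h hh y x hy hx0 hxy
  · intro x hx
    exact ⟨hx.1, le_csSup hbdd hx⟩
end

section
/- Let c be a real number with c > 1/log(4/3), and let A be a set of nonnegative integers such that the unordered representation function satisfies r_{A,2}(n) > c·log n for all n ≥ n₀ (for some n₀). Then A contains a subset B that is a minimal asymptotic basis of order 2 for ℕ₀: ℕ₀ \ (B+B) is finite, and for every b ∈ B the set ℕ₀ \ ((B\{b}) + (B\{b})) is infinite. -/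
open Pointwise

/-- The unordered representation function of order 2 of a set `A ⊆ ℕ`. -/
noncomputable def r2 (A : Set ℕ) (n : ℕ) : ℕ :=
  Nat.card {p : ℕ × ℕ // p.1 ∈ A ∧ p.2 ∈ A ∧ p.1 ≤ p.2 ∧ p.1 + p.2 = n}

/-- Off-diagonal representations of `m`, indexed by the smaller summand. -/
noncomputable def eSet (X : Set ℕ) (m : ℕ) : Finset ℕ := by
  classical
  exact (Finset.range (m + 1)).filter (fun x => x ∈ X ∧ m - x ∈ X ∧ 2 * x < m)

lemma mem_eSet {X : Set ℕ} {m x : ℕ} :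
    x ∈ eSet X m ↔ x ∈ X ∧ m - x ∈ X ∧ 2 * x < m := by
  classical
  unfold eSet
  simp only [Finset.mem_filter, Finset.mem_range]
  constructor
  · rintro ⟨_, h⟩; exact h
  · intro h; exact ⟨by omega, h⟩

/-- The weight: pessimistic estimator for the probability that `m` is not represented. -/
noncomputable def wt (X : Set ℕ) (p : ℕ → ℝ) (m : ℕ) : ℝ :=
  ∏ i ∈ eSet X m, (1 - p i * p (m - i))

/-- Change of the values of `p` at two points. -/
noncomputable def upd (p : ℕ → ℝ) (x y : ℕ) (u v : ℝ) : ℕ → ℝ :=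
  fun z => if z = x then u else if z = y then v else p z

lemma part_affine (E : Finset ℕ) (p : ℕ → ℝ) (hp : ∀ z, 0 ≤ p z ∧ p z ≤ 1) (m x : ℕ)
    (hE : ∀ i ∈ E, 2 * i < m ∧ (i = x ∨ m - i = x)) :
    ∃ c : ℝ, 0 ≤ c ∧ c ≤ 1 ∧ ∀ (u : ℝ) (q : ℕ → ℝ), q x = u →
      (∀ z, z ≠ x → z + x = m → q z = p z) →
      ∏ i ∈ E, (1 - q i * q (m - i)) = 1 - c * u := by
  rcases E.eq_empty_or_nonempty with rfl | ⟨i, hi⟩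
  · exact ⟨0, le_refl _, zero_le_one, by simp⟩
  · have hEi : E = {i} := by
      ext j
      simp only [Finset.mem_singleton]
      constructor
      · intro hj
        have h1 := hE i hi
        have h2 := hE j hj
        omega
      · rintro rfl; exact hi
    obtain ⟨h1, h2⟩ := hE i hi
    subst hEi
    rcases h2 with h2 | h2
    · refine ⟨p (m - i), (hp _).1, (hp _).2, ?_⟩
      intro u q hu hq
      rw [Finset.prod_singleton, hq (m - i) (by omega) (by omega), h2, hu]
      ring
    · refine ⟨p i, (hp _).1, (hp _).2, ?_⟩
      intro u q hu hq
      rw [Finset.prod_singleton, hq i (by omega) (by omega), h2, hu]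

lemma wt_avg (X : Set ℕ) (p : ℕ → ℝ) (hp : ∀ z, 0 ≤ p z ∧ p z ≤ 1) (m x y : ℕ)
    (hxy : x ≠ y) (hm : x + y ≠ m) (hx : p x = 1 / 2) (hy : p y = 1 / 2) :
    wt X (upd p x y 1 0) m + wt X (upd p x y 0 1) m ≤ 2 * wt X p m := by
  classical
  have hself : p = upd p x y (1/2) (1/2) := by
    funext z
    unfold upd
    split_ifs with h1 h2
    · rw [h1, hx]
    · rw [h2, hy]
    · rfl
  set P : ℕ → Prop := fun i => i = x ∨ m - i = x with hP
  set Q : ℕ → Prop := fun i => i = y ∨ m - i = y with hQ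
  set E := eSet X m with hE
  set E1 := E.filter P with hE1
  set E2 := (E.filter (fun i => ¬ P i)).filter Q with hE2
  set E3 := (E.filter (fun i => ¬ P i)).filter (fun i => ¬ Q i) with hE3
  obtain ⟨c, hc0, hc1, hc⟩ := part_affine E1 p hp m x (by
    intro i hi
    rw [hE1, Finset.mem_filter] at hi
    exact ⟨(mem_eSet.1 hi.1).2.2, hi.2⟩)
  obtain ⟨d, hd0, hd1, hd⟩ := part_affine E2 p hp m y (by
    intro i hi
    rw [hE2, Finset.mem_filter, Finset.mem_filter] at hi
    exact ⟨(mem_eSet.1 hi.1.1).2.2, hi.2⟩)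
  set R := ∏ i ∈ E3, (1 - p i * p (m - i)) with hR
  have hR0 : 0 ≤ R := by
    apply Finset.prod_nonneg
    intro i _
    have h1 := hp i
    have h2 := hp (m - i)
    nlinarith
  have key : ∀ u v : ℝ, wt X (upd p x y u v) m = (1 - c * u) * ((1 - d * v) * R) := by
    intro u v
    unfold wt
    rw [← hE, ← Finset.prod_filter_mul_prod_filter_not E P,
      ← Finset.prod_filter_mul_prod_filter_not (E.filter (fun i => ¬ P i)) Q]
    rw [← hE1, ← hE2, ← hE3]
    rw [hc u (upd p x y u v) (by simp [upd]) (by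
      intro z hz hzm
      have : z ≠ y := by omega
      simp [upd, hz, this])]
    rw [hd v (upd p x y u v) (by simp [upd, hxy.symm]) (by
      intro z hz hzm
      have : z ≠ x := by omega
      simp [upd, hz, this])]
    congr 2
    apply Finset.prod_congr rfl
    intro i hi
    rw [hE3, Finset.mem_filter, Finset.mem_filter] at hi
    simp only [hP, hQ, not_or] at hi
    obtain ⟨⟨_, h1, h2⟩, h3, h4⟩ := hi
    simp [upd, h1, h2, h3, h4]
  have h3 : wt X p m = (1 - c * (1/2)) * ((1 - d * (1/2)) * R) := by
    rw [← key, ← hself]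
  rw [h3, key, key]
  have := mul_nonneg (mul_nonneg hc0 hd0) hR0
  nlinarith

lemma derand (X : Set ℕ) (S : Finset ℕ) (n : ℕ) (hS : ∀ m ∈ S, m ≠ n) :
    ∀ (t : ℕ) (p : ℕ → ℝ), (∀ z, p z = 0 ∨ p z = 1 / 2 ∨ p z = 1) →
      (∀ z, p z = 1 / 2 → z ≤ n ∧ p (n - z) = 1 / 2 ∧ 2 * z ≠ n) →
      ((Finset.range (n + 1)).filter (fun z => p z = 1 / 2)).card = t →
      ∃ q : ℕ → ℝ, (∀ z, q z = 0 ∨ q z = 1) ∧ (∀ z, p z ≠ 1 / 2 → q z = p z) ∧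
        (∀ z, p z = 1 / 2 → q z + q (n - z) = 1) ∧
        ∑ m ∈ S, wt X q m ≤ ∑ m ∈ S, wt X p m := by
  classical
  intro t
  induction t using Nat.strong_induction_on with
  | _ t ih =>
  intro p hp hpair hcard
  by_cases hex : ∃ x, p x = 1 / 2
  · obtain ⟨x, hx⟩ := hex
    obtain ⟨hxn, hy, hxx⟩ := hpair x hx
    obtain ⟨y, hyd⟩ : ∃ y, y = n - x := ⟨_, rfl⟩
    rw [← hyd] at hy
    have hxy : x ≠ y := by omega
    have hp01 : ∀ z, 0 ≤ p z ∧ p z ≤ 1 := by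
      intro z
      rcases hp z with h | h | h <;> rw [h] <;> norm_num
    have havg : ∑ m ∈ S, wt X (upd p x y 1 0) m + ∑ m ∈ S, wt X (upd p x y 0 1) m
        ≤ 2 * ∑ m ∈ S, wt X p m := by
      rw [← Finset.sum_add_distrib, Finset.mul_sum]
      apply Finset.sum_le_sum
      intro m hm
      have := hS m hm
      exact wt_avg X p hp01 m x y hxy (by omega) hx hy
    have main : ∀ u v : ℝ, (u = 0 ∨ u = 1) → (v = 0 ∨ v = 1) → u + v = 1 →
        ∑ m ∈ S, wt X (upd p x y u v) m ≤ ∑ m ∈ S, wt X p m →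
        ∃ q : ℕ → ℝ, (∀ z, q z = 0 ∨ q z = 1) ∧ (∀ z, p z ≠ 1 / 2 → q z = p z) ∧
        (∀ z, p z = 1 / 2 → q z + q (n - z) = 1) ∧
        ∑ m ∈ S, wt X q m ≤ ∑ m ∈ S, wt X p m := by
      intro u v hu hv huv hle
      have hu2 : u ≠ 1 / 2 := by rcases hu with h | h <;> rw [h] <;> norm_num
      have hv2 : v ≠ 1 / 2 := by rcases hv with h | h <;> rw [h] <;> norm_num
      have ux : upd p x y u v x = u := by simp [upd]
      have uy : upd p x y u v y = v := by simp [upd, hxy.symm]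
      have uz : ∀ z, z ≠ x → z ≠ y → upd p x y u v z = p z := by
        intro z h1 h2; simp [upd, h1, h2]
      have half : ∀ z, upd p x y u v z = 1 / 2 → z ≠ x ∧ z ≠ y ∧ p z = 1 / 2 := by
        intro z hz
        have h1 : z ≠ x := by rintro rfl; rw [ux] at hz; exact hu2 hz
        have h2 : z ≠ y := by rintro rfl; rw [uy] at hz; exact hv2 hz
        rw [uz z h1 h2] at hz
        exact ⟨h1, h2, hz⟩
      obtain ⟨q, q1, q2, q3, q4⟩ := ih
        ((Finset.range (n + 1)).filter (fun z => upd p x y u v z = 1 / 2)).card (by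
          rw [← hcard]
          apply Finset.card_lt_card
          rw [Finset.ssubset_iff_of_subset]
          · refine ⟨x, ?_, ?_⟩
            · simp only [Finset.mem_filter, Finset.mem_range]
              exact ⟨by omega, hx⟩
            · simp only [Finset.mem_filter, not_and]
              intro _
              rw [ux]; exact hu2
          · intro z hz
            simp only [Finset.mem_filter] at hz ⊢
            exact ⟨hz.1, (half z hz.2).2.2⟩) (upd p x y u v) (by
          intro z
          by_cases h1 : z = x
          · rw [h1, ux]; tauto
          by_cases h2 : z = y
          · rw [h2, uy]; tauto
          rw [uz z h1 h2]; exact hp z) (by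
          intro z hz
          obtain ⟨h1, h2, h3⟩ := half z hz
          obtain ⟨g1, g2, g3⟩ := hpair z h3
          refine ⟨g1, ?_, g3⟩
          rw [uz _ (by omega) (by omega)]
          exact g2) rfl
      have qx : q x = u := by rw [q2 x (by rw [ux]; exact hu2), ux]
      have qy : q y = v := by rw [q2 y (by rw [uy]; exact hv2), uy]
      refine ⟨q, q1, ?_, ?_, le_trans q4 hle⟩
      · intro z hz
        have h1 : z ≠ x := by rintro rfl; exact hz hx
        have h2 : z ≠ y := by rintro rfl; exact hz hy
        rw [q2 z (by rw [uz z h1 h2]; exact hz), uz z h1 h2]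
      · intro z hz
        by_cases h1 : z = x
        · rw [h1, ← hyd, qx, qy]; exact huv
        by_cases h2 : z = y
        · have : n - y = x := by omega
          rw [h2, this, qx, qy]; linarith
        exact q3 z (by rw [uz z h1 h2]; exact hz)
    by_cases hcase : ∑ m ∈ S, wt X (upd p x y 1 0) m ≤ ∑ m ∈ S, wt X p m
    · exact main 1 0 (by simp) (by simp) (by norm_num) hcase
    · exact main 0 1 (by simp) (by simp) (by norm_num) (by linarith)
  · push Not at hex
    refine ⟨p, ?_, fun z _ => rfl, fun z hz => absurd hz (hex z), le_refl _⟩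
    intro z
    have := hex z
    have := hp z
    tauto

lemma powb {e g t : ℕ} (h : e ≤ g + t) :
    (3 / 4 : ℝ) ^ g ≤ (4 / 3 : ℝ) ^ t * (3 / 4 : ℝ) ^ e := by
  have h1 : (3 / 4 : ℝ) ^ (g + t) ≤ (3 / 4 : ℝ) ^ e :=
    pow_le_pow_of_le_one (by norm_num) (by norm_num) h
  calc (3 / 4 : ℝ) ^ g = (4 / 3 : ℝ) ^ t * (3 / 4 : ℝ) ^ (g + t) := by
        rw [pow_add, mul_left_comm, ← mul_pow]; norm_num
    _ ≤ _ := by gcongr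

lemma tail_small (f : ℕ → ℝ) (hf : Summable f) (ε : ℝ) (hε : 0 < ε) :
    ∃ k : ℕ, ∀ S : Finset ℕ, (∀ m ∈ S, k ≤ m) → ∑ m ∈ S, f m < ε := by
  obtain ⟨s, hs⟩ := summable_iff_vanishing_norm.1 hf ε hε
  refine ⟨s.sup id + 1, fun S hS => ?_⟩
  refine lt_of_le_of_lt (le_abs_self _) (hs S ?_)
  rw [Finset.disjoint_left]
  intro a ha has
  have h1 := hS a ha
  have h2 : id a ≤ s.sup id := Finset.le_sup has
  simp only [id] at h2
  omega

lemma large_e {X : Set ℕ} (hX : Summable (fun m => (3 / 4 : ℝ) ^ (eSet X m).card)) (C : ℕ) :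
    ∃ L : ℕ, ∀ m, L ≤ m → C < (eSet X m).card := by
  have h := hX.tendsto_atTop_zero.eventually_lt_const
    (show (0 : ℝ) < (3 / 4 : ℝ) ^ C by positivity)
  obtain ⟨L, hL⟩ := Filter.eventually_atTop.1 h
  refine ⟨L, fun m hm => ?_⟩
  exact (pow_lt_pow_iff_right_of_lt_one₀ (by norm_num) (by norm_num)).1 (hL m hm)

lemma wt_le (X : Set ℕ) (p : ℕ → ℝ) (hp : ∀ z, p z = 0 ∨ p z = 1 / 2 ∨ p z = 1) (m : ℕ)
    (Z : Finset ℕ) (hZ : ∀ z, z ≤ m → p z = 0 → z ∈ Z) :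
    wt X p m ≤ (4 / 3 : ℝ) ^ (2 * Z.card) * (3 / 4 : ℝ) ^ (eSet X m).card := by
  classical
  set G := eSet X m \ (Z ∪ Z.image (fun z => m - z)) with hG
  have hcard : (eSet X m).card ≤ G.card + 2 * Z.card := by
    have h1 := Finset.card_le_card_sdiff_add_card (t := Z ∪ Z.image (fun z => m - z))
      (s := eSet X m)
    rw [← hG] at h1
    have h2 := Finset.card_union_le Z (Z.image (fun z => m - z))
    have h3 : (Z.image (fun z => m - z)).card ≤ Z.card := Finset.card_image_le
    omega
  refine le_trans ?_ (powb hcard)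
  have h0 : ∀ i, 0 ≤ 1 - p i * p (m - i) ∧ 1 - p i * p (m - i) ≤ 1 := by
    intro i
    rcases hp i with h | h | h <;> rcases hp (m - i) with h' | h' | h' <;> rw [h, h'] <;> norm_num
  calc wt X p m ≤ ∏ i ∈ G, (1 - p i * p (m - i)) := by
        unfold wt
        rw [← Finset.prod_sdiff (show G ⊆ eSet X m from Finset.sdiff_subset)]
        have a1 : ∏ i ∈ eSet X m \ G, (1 - p i * p (m - i)) ≤ 1 :=
          Finset.prod_le_one (fun i _ => (h0 i).1) (fun i _ => (h0 i).2)
        have a2 : 0 ≤ ∏ i ∈ G, (1 - p i * p (m - i)) :=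
          Finset.prod_nonneg (fun i _ => (h0 i).1)
        nlinarith
    _ ≤ ∏ i ∈ G, (3 / 4 : ℝ) := by
        apply Finset.prod_le_prod (fun i _ => (h0 i).1)
        intro i hi
        rw [hG, Finset.mem_sdiff, Finset.mem_union, not_or] at hi
        obtain ⟨hi1, hi2, hi3⟩ := hi
        have hi4 := (mem_eSet.1 hi1).2.2
        have b1 : p i ≠ 0 := fun h => hi2 (hZ i (by omega) h)
        have b2 : p (m - i) ≠ 0 := by
          intro h
          apply hi3
          rw [Finset.mem_image]
          exact ⟨m - i, hZ _ (by omega) h, by omega⟩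
        rcases hp i with h | h | h
        · exact absurd h b1
        all_goals
          rcases hp (m - i) with h' | h' | h'
          · exact absurd h' b2
          all_goals rw [h, h']; norm_num
    _ = _ := by rw [Finset.prod_const]

/-- Invariant of the construction. -/
def Good (m0 : ℕ) (X : Set ℕ) : Prop :=
  Summable (fun m => (3 / 4 : ℝ) ^ (eSet X m).card) ∧ ∀ m, m0 ≤ m → m ∈ X + X

lemma mem_add_of_eSet {X : Set ℕ} {m i : ℕ} (h : i ∈ eSet X m) : m ∈ X + X := by
  obtain ⟨h1, h2, h3⟩ := mem_eSet.1 h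
  exact Set.mem_add.2 ⟨i, h1, m - i, h2, by omega⟩

lemma step_s15 (m0 : ℕ) (X : Set ℕ) (hX : Good m0 X) (b : ℕ) (hb : b ∈ X) (K : ℕ) :
    ∃ Y ⊆ X, Good m0 Y ∧ (∀ x, x < K → x ∈ X → x ∈ Y) ∧
      ∃ n, K ≤ n ∧ n ∉ (Y \ {b}) + (Y \ {b}) := by
  classical
  obtain ⟨hsum, hrep⟩ := hX
  obtain ⟨k1, hk1⟩ := tail_small _ hsum (1 / 2) (by norm_num)
  obtain ⟨M, hM⟩ : ∃ M, M = k1 + K + b + 1 := ⟨_, rfl⟩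
  obtain ⟨k2, hk2⟩ := tail_small _ (hsum.mul_left ((4 / 3 : ℝ) ^ (2 * (M + 1)))) (1 / 2)
    (by norm_num)
  obtain ⟨L0, hL0⟩ := large_e hsum 0
  obtain ⟨i0, hi0⟩ := Finset.card_pos.1 (hL0 (L0 + 2 * (2 * k2 + 2 * M + 2)) (by omega))
  obtain ⟨_, hyX, hi0'⟩ := mem_eSet.1 hi0
  obtain ⟨y, hy⟩ : ∃ y, y = L0 + 2 * (2 * k2 + 2 * M + 2) - i0 := ⟨_, rfl⟩
  rw [← hy] at hyX
  have hybig : 2 * k2 + 2 * M + 2 ≤ y := by omega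
  clear hy hi0 hi0'
  obtain ⟨n, hn⟩ : ∃ n, n = b + y := ⟨_, rfl⟩
  obtain ⟨L, hL⟩ := large_e hsum (n + 1)
  set p : ℕ → ℝ := fun x => if x < M ∨ n < x ∨ x = y then 1 else
    if n < x + M ∨ 2 * x = n then 0 else 1 / 2 with hpdef
  have p1 : ∀ x, (x < M ∨ n < x ∨ x = y) → p x = 1 := by
    intro x h; simp only [hpdef, if_pos h]
  have p0 : ∀ x, ¬ (x < M ∨ n < x ∨ x = y) → (n < x + M ∨ 2 * x = n) → p x = 0 := by
    intro x h h'; simp only [hpdef, if_neg h, if_pos h']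
  have ph : ∀ x, ¬ (x < M ∨ n < x ∨ x = y) → ¬ (n < x + M ∨ 2 * x = n) → p x = 1 / 2 := by
    intro x h h'; simp only [hpdef, if_neg h, if_neg h']
  have p1' : ∀ x, p x = 1 → (x < M ∨ n < x ∨ x = y) := by
    intro x h
    by_contra h1
    by_cases h2 : n < x + M ∨ 2 * x = n
    · rw [p0 x h1 h2] at h; norm_num at h
    · rw [ph x h1 h2] at h; norm_num at h
  have p0' : ∀ x, p x = 0 → (x ≤ n ∧ (n < x + M ∨ 2 * x = n)) := by
    intro x h
    by_cases h1 : x < M ∨ n < x ∨ x = y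
    · rw [p1 x h1] at h; norm_num at h
    by_cases h2 : n < x + M ∨ 2 * x = n
    · exact ⟨by omega, h2⟩
    · rw [ph x h1 h2] at h; norm_num at h
  have ph' : ∀ x, p x = 1 / 2 → ¬ (x < M ∨ n < x ∨ x = y) ∧ ¬ (n < x + M ∨ 2 * x = n) := by
    intro x h
    by_cases h1 : x < M ∨ n < x ∨ x = y
    · rw [p1 x h1] at h; norm_num at h
    by_cases h2 : n < x + M ∨ 2 * x = n
    · rw [p0 x h1 h2] at h; norm_num at h
    · exact ⟨h1, h2⟩
  have hp : ∀ z, p z = 0 ∨ p z = 1 / 2 ∨ p z = 1 := by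
    intro x
    by_cases h1 : x < M ∨ n < x ∨ x = y
    · exact Or.inr (Or.inr (p1 x h1))
    by_cases h2 : n < x + M ∨ 2 * x = n
    · exact Or.inl (p0 x h1 h2)
    · exact Or.inr (Or.inl (ph x h1 h2))
  clear_value p
  set S : Finset ℕ := (Finset.Icc M L).erase n with hS
  obtain ⟨q, q1, q2, q3, q4⟩ := derand X S n (fun m hm => Finset.ne_of_mem_erase hm) _ p hp (by
    intro z hz
    obtain ⟨h1, h2⟩ := ph' z hz
    exact ⟨by omega, ph _ (by omega) (by omega), by omega⟩) rfl
  have qp1 : ∀ x, p x = 1 → q x = 1 := by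
    intro x h
    rw [q2 x (by rw [h]; norm_num), h]
  -- the estimate
  have hest : ∑ m ∈ S, wt X p m < 1 := by
    rw [← Finset.sum_filter_add_sum_filter_not S (fun m => 2 * m < n)]
    have e1 : ∑ m ∈ S.filter (fun m => 2 * m < n), wt X p m < 1 / 2 := by
      refine lt_of_le_of_lt (Finset.sum_le_sum (g := fun m => (3 / 4 : ℝ) ^ (eSet X m).card) ?_)
        (hk1 _ ?_)
      · intro m hm
        rw [Finset.mem_filter] at hm
        have := wt_le X p hp m ∅ (by
          intro z hz hz0
          have := p0' z hz0
          omega)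
        simpa using this
      · intro m hm
        simp only [hS, Finset.mem_filter, Finset.mem_erase, Finset.mem_Icc] at hm
        omega
    have e2 : ∑ m ∈ S.filter (fun m => ¬ 2 * m < n), wt X p m < 1 / 2 := by
      refine lt_of_le_of_lt (Finset.sum_le_sum (g := fun m =>
        (4 / 3 : ℝ) ^ (2 * (M + 1)) * (3 / 4 : ℝ) ^ (eSet X m).card) ?_) (hk2 _ ?_)
      · intro m hm
        have h1 := wt_le X p hp m (insert (n / 2) (Finset.Icc (n + 1 - M) n)) (by
          intro z hz hz0
          have := p0' z hz0
          simp only [Finset.mem_insert, Finset.mem_Icc]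
          omega)
        refine le_trans h1 ?_
        have h2 : (insert (n / 2) (Finset.Icc (n + 1 - M) n)).card ≤ M + 1 := by
          have := Finset.card_insert_le (n / 2) (Finset.Icc (n + 1 - M) n)
          rw [Nat.card_Icc] at this
          omega
        gcongr
        norm_num
      · intro m hm
        simp only [Finset.mem_filter] at hm
        omega
    linarith
  set Y : Set ℕ := {x | x ∈ X ∧ q x = 1} with hY
  have hcard : ∀ m, (eSet X m).card ≤ (eSet Y m).card + (n + 1) := by
    intro m
    have hsub : eSet X m ⊆ eSet Y m ∪ Finset.range (n + 1) := by
      intro i hi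
      rw [Finset.mem_union, Finset.mem_range]
      obtain ⟨h1, h2, h3⟩ := mem_eSet.1 hi
      by_cases hin : i < n + 1
      · exact Or.inr hin
      · left
        refine mem_eSet.2 ⟨⟨h1, qp1 _ (p1 _ ?_)⟩, ⟨h2, qp1 _ (p1 _ ?_)⟩, h3⟩ <;> omega
    have h1 := Finset.card_le_card hsub
    have h2 := Finset.card_union_le (eSet Y m) (Finset.range (n + 1))
    rw [Finset.card_range] at h2
    omega
  refine ⟨Y, fun x hx => hx.1, ⟨?_, ?_⟩, ?_, n, by omega, ?_⟩
  · refine Summable.of_nonneg_of_le (fun m => by positivity) (fun m => powb (hcard m))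
      (hsum.mul_left _)
  · intro m hm
    by_cases c1 : m < M
    · obtain ⟨a, ha, a', ha', haa⟩ := Set.mem_add.1 (hrep m hm)
      exact Set.mem_add.2 ⟨a, ⟨ha, qp1 _ (p1 _ (by omega))⟩, a',
        ⟨ha', qp1 _ (p1 _ (by omega))⟩, haa⟩
    by_cases c2 : m = n
    · exact Set.mem_add.2 ⟨b, ⟨hb, qp1 _ (p1 _ (by omega))⟩, y,
        ⟨hyX, qp1 _ (p1 _ (by omega))⟩, by omega⟩
    by_cases c3 : L ≤ m
    · have h1 := hL m c3
      have h2 := hcard m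
      obtain ⟨i, hi⟩ := Finset.card_pos.1 (show 0 < (eSet Y m).card by omega)
      exact mem_add_of_eSet hi
    by_contra hno
    have hw : wt X q m = 1 := by
      unfold wt
      apply Finset.prod_eq_one
      intro i hi
      obtain ⟨h1, h2, h3⟩ := mem_eSet.1 hi
      rcases q1 i with g | g
      · rw [g]; ring
      rcases q1 (m - i) with g' | g'
      · rw [g']; ring
      · exact absurd (mem_add_of_eSet (X := Y) (mem_eSet.2 ⟨⟨h1, g⟩, ⟨h2, g'⟩, h3⟩)) hno
    have hmS : m ∈ S := by
      simp only [hS, Finset.mem_erase, Finset.mem_Icc]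
      omega
    have hle : wt X q m ≤ ∑ m ∈ S, wt X q m := by
      apply Finset.single_le_sum (f := fun m => wt X q m) _ hmS
      intro j _
      apply Finset.prod_nonneg
      intro i _
      rcases q1 i with g | g <;> rcases q1 (j - i) with g' | g' <;> rw [g, g'] <;> norm_num
    linarith
  · intro x hx hxX
    exact ⟨hxX, qp1 _ (p1 _ (by omega))⟩
  · intro hmem
    obtain ⟨a, ⟨⟨_, ha⟩, hab⟩, a', ⟨⟨_, ha'⟩, hab'⟩, haa⟩ := Set.mem_add.1 hmem
    simp only [Set.mem_singleton_iff] at hab hab'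
    have e1 : n - a = a' := by omega
    have e2 : n - a' = a := by omega
    have f1 : p a ≠ 1 / 2 := by
      intro h
      have := q3 a h
      rw [e1, ha, ha'] at this
      norm_num at this
    have f2 : p a' ≠ 1 / 2 := by
      intro h
      have := q3 a' h
      rw [e2, ha, ha'] at this
      norm_num at this
    have g1 := p1' a (by rw [← q2 a f1, ha])
    have g2 := p1' a' (by rw [← q2 a' f2, ha'])
    omega

lemma r2_le (A : Set ℕ) (n : ℕ) : r2 A n ≤ (eSet A n).card + 1 := by
  classical
  unfold r2
  have h := Nat.card_le_card_of_injective
    (fun p : {p : ℕ × ℕ // p.1 ∈ A ∧ p.2 ∈ A ∧ p.1 ≤ p.2 ∧ p.1 + p.2 = n} =>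
      (⟨p.1.1, by
        obtain ⟨⟨a, a'⟩, h1, h2, h3, h4⟩ := p
        simp only at h1 h2 h3 h4
        rw [Finset.mem_insert, mem_eSet]
        by_cases h : 2 * a = n
        · left; simp only; omega
        · right
          have e : n - a = a' := by omega
          simp only
          rw [e]
          exact ⟨h1, h2, by omega⟩⟩ : (insert (n / 2) (eSet A n) : Finset ℕ))) (by
      rintro ⟨⟨a, a'⟩, h1, h2, h3, h4⟩ ⟨⟨d, d'⟩, g1, g2, g3, g4⟩ h
      simp only [Subtype.mk.injEq] at h h4 g4
      simp only [Subtype.mk.injEq, Prod.mk.injEq]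
      omega)
  refine le_trans h ?_
  rw [Nat.card_eq_fintype_card, Fintype.card_coe]
  exact Finset.card_insert_le _ _

lemma summable_start (c : ℝ) (hc : 1 / Real.log (4 / 3) < c) (A : Set ℕ)
    (n₀ : ℕ) (hA : ∀ n : ℕ, n₀ ≤ n → c * Real.log (n : ℝ) < (r2 A n : ℝ)) :
    Summable (fun m => (3 / 4 : ℝ) ^ (eSet A m).card) := by
  have hl : 0 < Real.log (4 / 3) := Real.log_pos (by norm_num)
  have hc1 : 1 < c * Real.log (4 / 3) := by
    rwa [div_lt_iff₀ hl] at hc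
  have hs : Summable (fun m : ℕ => (4 / 3 : ℝ) ^ 1 * (m : ℝ) ^ (-(c * Real.log (4 / 3)))) :=
    (Real.summable_nat_rpow.2 (by linarith)).mul_left _
  refine Summable.of_norm_bounded_eventually_nat hs ?_
  filter_upwards [Filter.eventually_ge_atTop (n₀ + 1)] with m hm
  rw [Real.norm_of_nonneg (by positivity)]
  refine le_trans (powb (r2_le A m)) ?_
  gcongr
  have hm0 : (0 : ℝ) < m := by exact_mod_cast (by omega : 0 < m)
  rw [Real.rpow_def_of_pos hm0, ← Real.rpow_natCast, Real.rpow_def_of_pos (by norm_num)]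
  apply Real.exp_le_exp.2
  have h34 : Real.log (3 / 4) = - Real.log (4 / 3) := by
    rw [← Real.log_inv]; norm_num
  rw [h34]
  have := hA m (by omega)
  nlinarith

/-- Erdős–Nathanson: if `r_{A,2}(n) > c log n` for some `c > 1/log(4/3)` and all
sufficiently large `n`, then `A` contains a minimal asymptotic basis of order 2. -/
theorem stmt15 (c : ℝ) (hc : 1 / Real.log (4 / 3) < c) (A : Set ℕ)
    (n₀ : ℕ) (hA : ∀ n : ℕ, n₀ ≤ n → c * Real.log (n : ℝ) < (r2 A n : ℝ)) :
    ∃ B ⊆ A, {n : ℕ | n ∉ B + B}.Finite ∧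
      ∀ b ∈ B, {n : ℕ | n ∉ (B \ {b}) + (B \ {b})}.Infinite := by
  classical
  have hsum := summable_start c hc A n₀ hA
  obtain ⟨m0, hm0⟩ := large_e hsum 0
  have hGA : Good m0 A := ⟨hsum, fun m hm => by
    obtain ⟨i, hi⟩ := Finset.card_pos.1 (hm0 m hm)
    exact mem_add_of_eSet hi⟩
  have hstep : ∀ (X : {X : Set ℕ // Good m0 X}) (b K : ℕ), ∃ Y : {X : Set ℕ // Good m0 X},
      Y.1 ⊆ X.1 ∧ (∀ x, x < K → x ∈ X.1 → x ∈ Y.1) ∧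
      (b ∈ X.1 → ∃ n, K ≤ n ∧ n ∉ (Y.1 \ {b}) + (Y.1 \ {b})) := by
    intro X b K
    by_cases hb : b ∈ X.1
    · obtain ⟨Y, h1, h2, h3, h4⟩ := step_s15 m0 X.1 X.2 b hb K
      exact ⟨⟨Y, h2⟩, h1, h3, fun _ => h4⟩
    · exact ⟨X, subset_rfl, fun _ _ h => h, fun h => absurd h hb⟩
  choose f f1 f2 f3 using hstep
  let G : ℕ → {X : Set ℕ // Good m0 X} := fun j =>
    Nat.rec ⟨A, hGA⟩ (fun j X => f X (Nat.unpair j).1 j) j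
  have Gs : ∀ j, G (j + 1) = f (G j) (Nat.unpair j).1 j := fun j => rfl
  have G0 : (G 0).1 = A := rfl
  have hanti : Antitone (fun j => (G j).1) := by
    apply antitone_nat_of_succ_le
    intro j
    rw [Gs]
    exact f1 _ _ _
  have hkeep : ∀ j x, x < j → x ∈ (G j).1 → ∀ k, x ∈ (G k).1 := by
    intro j x hxj hx k
    rcases le_total k j with h | h
    · exact hanti h hx
    · induction k, h using Nat.le_induction with
      | base => exact hx
      | succ k hk ih =>
        rw [Gs]
        exact f2 _ _ _ x (by omega) ih
  refine ⟨⋂ j, (G j).1, ?_, ?_, ?_⟩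
  · rw [← G0]
    exact Set.iInter_subset _ 0
  · refine (Set.finite_lt_nat m0).subset ?_
    intro m hm
    by_contra hlt
    simp only [Set.mem_ofPred_eq, not_lt] at hm hlt
    apply hm
    obtain ⟨a, ha, a', ha', haa⟩ := Set.mem_add.1 ((G (m + 1)).2.2 m hlt)
    exact Set.mem_add.2 ⟨a, Set.mem_iInter.2 (hkeep (m + 1) a (by omega) ha), a',
      Set.mem_iInter.2 (hkeep (m + 1) a' (by omega) ha'), haa⟩
  · intro b hb
    apply Set.infinite_of_forall_exists_gt
    intro K
    obtain ⟨j, hj⟩ : ∃ j, j = Nat.pair b (K + 1) := ⟨_, rfl⟩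
    have hjK : K + 1 ≤ j := hj ▸ Nat.right_le_pair _ _
    have hjb : (Nat.unpair j).1 = b := by rw [hj, Nat.unpair_pair]
    obtain ⟨n, hn1, hn2⟩ := f3 (G j) b j (Set.mem_iInter.1 hb j)
    refine ⟨n, ?_, by omega⟩
    intro hmem
    apply hn2
    have hsub : (⋂ j, (G j).1) ⊆ (f (G j) b j).1 := by
      have := Set.iInter_subset (fun j => (G j).1) (j + 1)
      rw [Gs, hjb] at this
      exact this
    exact Set.add_subset_add (Set.sdiff_subset_sdiff_left hsub)
      (Set.sdiff_subset_sdiff_left hsub) hmem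
end

section
/- For every integer r ≥ 1, there exists an r-minimal asymptotic basis of order 2 for ℕ₀: a set A of nonnegative integers such that for every subset S ⊆ A, the set ℕ₀ \ ((A\S)+(A\S)) is finite if and only if |S| < r. -/
open Pointwise

namespace RMin

/-- The base of the geometric sequence of targets (odd and large). -/
def base (r : ℕ) : ℕ := 2 * (100 * r ^ 2) + 101

/-- The targets. -/
def tgt (r k : ℕ) : ℕ := base r ^ (k + 1)

/-- Enumeration of finite sets in which each one occurs infinitely often. -/
def enum (k : ℕ) : Finset ℕ := (Encodable.decode (α := Finset ℕ) (Nat.unpair k).2).getD ∅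

/-- The gap pattern. -/
def gap (r n x : ℕ) : Prop := 3 * n ≤ x ∧ x < 4 * n ∧ ((x - 3 * n) / (8 * r)) % 2 = 1

/-- The finite set `F` is to be used as the exact representation set. -/
def good (r k : ℕ) (B : Set ℕ) : Prop :=
  (enum k).card = r ∧ ∀ f ∈ enum k, f ∈ B ∧ f ≤ tgt r k

/-- The lower half of the next stage. -/
def low (r k : ℕ) (B : Set ℕ) : Set ℕ :=
  {x | x ∈ B ∨ (tgt r k < x ∧ 2 * x < tgt r (k + 1) ∧ ¬ gap r (tgt r k) x)}

/-- The stages of the construction. -/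
def stage (r : ℕ) : ℕ → Set ℕ
  | 0 => {x | x ≤ tgt r 0}
  | k + 1 => {y | y ∈ low r k (stage r k) ∨
      (y ≤ tgt r (k + 1) ∧ tgt r (k + 1) < 2 * y ∧
        (tgt r (k + 1) - y ∉ low r k (stage r k) ∨ tgt r (k + 1) - y ∈ enum k
          ∨ ¬ good r k (stage r k)))}

/-- The basis. -/
def bas (r : ℕ) : Set ℕ := {x | ∃ k, x ∈ stage r k}

lemma tgt_succ (r k : ℕ) : tgt r (k + 1) = base r * tgt r k := by
  unfold tgt; rw [pow_succ]; ring

lemma tgt_odd (r k : ℕ) : tgt r k % 2 = 1 := by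
  have : Odd (base r) := ⟨100 * r ^ 2 + 50, by unfold base; ring⟩
  exact Nat.odd_iff.mp (this.pow)

lemma tgt_pos (r k : ℕ) : 0 < tgt r k := by have := tgt_odd r k; omega

lemma tgt_growth (r k : ℕ) : 101 * tgt r k ≤ tgt r (k + 1) := by
  rw [tgt_succ]; apply Nat.mul_le_mul_right; unfold base; omega

lemma tgt_mono (r : ℕ) : StrictMono (tgt r) := by
  apply strictMono_nat_of_lt_succ
  intro k
  have := tgt_growth r k
  have := tgt_pos r k
  omega

lemma tgt_big (r k : ℕ) : 200 * r ^ 2 + 101 ≤ tgt r k := by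
  have h : tgt r 0 ≤ tgt r k := (tgt_mono r).monotone (Nat.zero_le k)
  have : tgt r 0 = 200 * r ^ 2 + 101 := by unfold tgt base; ring
  omega

lemma lt_tgt (r k : ℕ) : k < tgt r k := by
  induction k with
  | zero => exact tgt_pos r 0
  | succ k ih =>
    have := tgt_growth r k
    omega

lemma stage_le (r k x : ℕ) (h : x ∈ stage r k) : x ≤ tgt r k := by
  induction k with
  | zero => exact h
  | succ k ih =>
    have := tgt_growth r k
    rcases h with (h | h) | h
    · have := ih h
      omega
    · omega
    · exact h.1

lemma stage_succ (r k x : ℕ) (hx : x ≤ tgt r k) : x ∈ stage r (k + 1) ↔ x ∈ stage r k := by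
  have := tgt_growth r k
  have := tgt_pos r k
  constructor
  · rintro ((h | h) | h)
    · exact h
    · omega
    · omega
  · intro h
    exact Or.inl (Or.inl h)

lemma stage_add (r k j x : ℕ) (hx : x ≤ tgt r k) : x ∈ stage r (k + j) ↔ x ∈ stage r k := by
  induction j with
  | zero => rfl
  | succ j ih =>
    rw [← ih, ← add_assoc]
    apply stage_succ
    exact hx.trans ((tgt_mono r).monotone (by omega))

lemma mem_bas (r k x : ℕ) (hx : x ≤ tgt r k) : x ∈ bas r ↔ x ∈ stage r k := by
  constructor
  · rintro ⟨j, hj⟩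
    rcases le_total k j with h | h
    · obtain ⟨i, rfl⟩ := Nat.exists_eq_add_of_le h
      exact (stage_add r k i x hx).1 hj
    · obtain ⟨i, rfl⟩ := Nat.exists_eq_add_of_le h
      exact (stage_add r j i x (stage_le r j x hj)).2 hj
  · intro h
    exact ⟨k, h⟩

lemma small_mem (r x : ℕ) (hx : x ≤ 200 * r ^ 2 + 101) : x ∈ bas r := by
  have := tgt_big r 0
  exact ⟨0, by show x ≤ _; omega⟩

lemma mid_mem (r k x : ℕ) (h1 : tgt r k < x) (h2 : 2 * x < tgt r (k + 1)) :
    x ∈ bas r ↔ ¬ gap r (tgt r k) x := by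
  rw [mem_bas r (k + 1) x (by omega)]
  constructor
  · rintro ((h | h) | h)
    · have := stage_le r k x h
      omega
    · exact h.2.2
    · omega
  · intro h
    exact Or.inl (Or.inr ⟨h1, h2, h⟩)

lemma low_mem (r k x : ℕ) (h2 : 2 * x < tgt r (k + 1)) :
    x ∈ bas r ↔ x ∈ low r k (stage r k) := by
  rw [mem_bas r (k + 1) x (by omega)]
  constructor
  · rintro (h | h)
    · exact h
    · omega
  · intro h
    exact Or.inl h

lemma good_iff (r k : ℕ) : good r k (stage r k) ↔ good r k (bas r) := by
  unfold good
  refine and_congr_right fun _ => forall_congr' fun f => forall_congr' fun _ => ?_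
  constructor
  · rintro ⟨h, h'⟩
    exact ⟨(mem_bas r k f h').2 h, h'⟩
  · rintro ⟨h, h'⟩
    exact ⟨(mem_bas r k f h').1 h, h'⟩

lemma high_mem (r k x : ℕ) (h2 : 2 * x < tgt r (k + 1)) :
    tgt r (k + 1) - x ∈ bas r ↔ (x ∉ bas r ∨ x ∈ enum k ∨ ¬ good r k (bas r)) := by
  have e : tgt r (k + 1) - (tgt r (k + 1) - x) = x := by omega
  rw [mem_bas r (k + 1) _ (by omega), low_mem r k x h2, ← good_iff]
  constructor
  · rintro ((h | h) | h)
    · have := stage_le r k _ h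
      have := tgt_growth r k
      omega
    · omega
    · rw [e] at h
      exact h.2.2
  · intro h
    refine Or.inr ⟨by omega, by omega, ?_⟩
    rw [e]
    exact h

/-- `m` has `r` pairwise disjoint representations. -/
def rep (r m : ℕ) : Prop :=
  ∃ T : Finset ℕ, T.card = r ∧ ∀ x ∈ T, x ∈ bas r ∧ m - x ∈ bas r ∧ 2 * x ≤ m

lemma rep_of (r m : ℕ) (h : ℕ → ℕ) (hi : ∀ i < r, ∀ j < r, h i = h j → i = j)
    (hh : ∀ i < r, h i ∈ bas r ∧ m - h i ∈ bas r ∧ 2 * h i ≤ m) : rep r m := by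
  refine ⟨(Finset.range r).image h, ?_, ?_⟩
  · rw [Finset.card_image_of_injOn, Finset.card_range]
    intro i hi' j hj' hij
    exact hi i (by simpa using hi') j (by simpa using hj') hij
  · intro x hx
    obtain ⟨i, hi', rfl⟩ := Finset.mem_image.1 hx
    exact hh i (by simpa using hi')

lemma not_gap_lo (r n x : ℕ) (h : x < 3 * n) : ¬ gap r n x := by
  rintro ⟨h1, -⟩; omega

lemma not_gap_hi (r n x : ℕ) (h : 4 * n ≤ x) : ¬ gap r n x := by
  rintro ⟨-, h1, -⟩; omega

lemma div_block (L q t : ℕ) (h1 : q * L ≤ t) (h2 : t < q * L + L) : t / L = q := by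
  apply Nat.div_eq_of_lt_le h1
  rw [Nat.succ_mul]; exact h2

lemma gap_block (r n i x : ℕ) (h1 : 3 * n + (2 * i + 1) * (8 * r) ≤ x)
    (h2 : x < 3 * n + (2 * i + 1) * (8 * r) + 8 * r) (h3 : x < 4 * n) : gap r n x := by
  refine ⟨by omega, h3, ?_⟩
  rw [div_block (8 * r) (2 * i + 1) (x - 3 * n) (by omega) (by omega)]
  omega

lemma not_gap_block (r n i x : ℕ) (h1 : 3 * n + (2 * i) * (8 * r) ≤ x)
    (h2 : x < 3 * n + (2 * i) * (8 * r) + 8 * r) : ¬ gap r n x := by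
  rintro ⟨-, -, h⟩
  rw [div_block (8 * r) (2 * i) (x - 3 * n) (by omega) (by omega)] at h
  omega

lemma rep_all (r : ℕ) (hr : 1 ≤ r) (m : ℕ) (hm : tgt r 0 + 8 * r < m) : rep r m := by
  obtain ⟨k, hk1, hk2⟩ : ∃ k, tgt r k + 8 * r < m ∧ m ≤ tgt r (k + 1) + 8 * r := by
    have hex : ∃ j, m ≤ tgt r j + 8 * r := ⟨m, by have := lt_tgt r m; omega⟩
    classical
    have h1 := Nat.find_spec hex
    have h0 : Nat.find hex ≠ 0 := by
      intro h
      rw [h] at h1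
      omega
    obtain ⟨k, hk⟩ := Nat.exists_eq_succ_of_ne_zero h0
    refine ⟨k, ?_, ?_⟩
    · have := Nat.find_min hex (m := k) (by omega)
      omega
    · rw [hk] at h1
      exact h1
  have hodd := tgt_odd r (k + 1)
  have hgr := tgt_growth r k
  have hbig := tgt_big r k
  have hmid := mid_mem r k
  have hhigh := high_mem r k
  have hgood : ∀ f ∈ enum k, good r k (bas r) → f ∈ bas r ∧ f ≤ tgt r k := fun f hf h => h.2 f hf
  have hcard : good r k (bas r) → (enum k).card = r := fun h => h.1
  have hsm := small_mem r
  have hrr : r ≤ r ^ 2 := by nlinarith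
  generalize tgt r (k + 1) = n' at *
  generalize tgt r k = n at *
  by_cases ha : m < 3 * n
  · refine rep_of r m (fun i => i) (fun i _ j _ h => h) fun i hi => ⟨?_, ?_, ?_⟩
    · exact hsm _ (by omega)
    · exact (hmid _ (by omega) (by omega)).2 (not_gap_lo _ _ _ (by omega))
    · show 2 * i ≤ m
      omega
  by_cases hb : 2 * m ≤ 11 * n
  · refine rep_of r m (fun i => m / 2 - i) (fun i _ j _ h => by omega)
      fun i hi => ⟨?_, ?_, ?_⟩
    · exact (hmid _ (by omega) (by omega)).2 (not_gap_lo _ _ _ (by omega))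
    · exact (hmid _ (by omega) (by omega)).2 (not_gap_lo _ _ _ (by omega))
    · omega
  by_cases hc : 2 * m ≤ n'
  · refine rep_of r m (fun i => n + 1 + i) (fun i _ j _ h => by omega)
      fun i hi => ⟨?_, ?_, ?_⟩
    · exact (hmid _ (by omega) (by omega)).2 (not_gap_lo _ _ _ (by omega))
    · exact (hmid _ (by omega) (by omega)).2 (not_gap_hi _ _ _ (by omega))
    · omega
  by_cases hd : m + 8 * r ≤ n'
  · refine rep_of r m (fun i => m / 2 - i) (fun i _ j _ h => by omega)
      fun i hi => ⟨?_, ?_, ?_⟩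
    · exact (hmid _ (by omega) (by omega)).2 (not_gap_hi _ _ _ (by omega))
    · exact (hmid _ (by omega) (by omega)).2 (not_gap_hi _ _ _ (by omega))
    · omega
  have hq : ∀ i < r, (2 * i + 1) * (8 * r) + 8 * r ≤ 16 * r ^ 2 := by
    intro i hi
    have : (i + 1) * r ≤ r * r := Nat.mul_le_mul_right _ hi
    nlinarith
  have hinj : ∀ i j : ℕ, (2 * i + 1) * (8 * r) = (2 * j + 1) * (8 * r) → i = j := by
    intro i j h
    have := Nat.eq_of_mul_eq_mul_right (by omega) h
    omega
  have hs1 : ∀ i, (2 * i + 1) * (8 * r) = (2 * i) * (8 * r) + 8 * r := fun i => by ring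
  have hs2 : ∀ i, (2 * (i + 1)) * (8 * r) = (2 * i + 1) * (8 * r) + 8 * r := fun i => by ring
  rcases lt_trichotomy m n' with he | he | he
  · refine rep_of r m (fun i => 3 * n + (2 * i + 1) * (8 * r) - 1) (fun i hi j hj h => ?_)
      fun i hi => ?_
    · have h1 := hs1 i
      have h2 := hs1 j
      exact hinj i j (by omega)
    · have h1 := hs1 i
      have h2 := hq i hi
      refine ⟨?_, ?_, ?_⟩
      · exact (hmid _ (by omega) (by omega)).2 (not_gap_block r n i _ (by omega) (by omega))
      · have e : m - (3 * n + (2 * i + 1) * (8 * r) - 1)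
            = n' - (3 * n + (2 * i + 1) * (8 * r) - 1 + (n' - m)) := by omega
        rw [e, hhigh _ (by omega), hmid _ (by omega) (by omega)]
        exact Or.inl (not_not.2 (gap_block r n i _ (by omega) (by omega) (by omega)))
      · omega
  · subst he
    by_cases hg : good r k (bas r)
    · refine ⟨enum k, hcard hg, fun x hx => ?_⟩
      obtain ⟨h1, h2⟩ := hgood x hx hg
      exact ⟨h1, (hhigh x (by omega)).2 (Or.inr (Or.inl hx)), by omega⟩
    · refine rep_of r m (fun i => n + 1 + i) (fun i _ j _ h => by omega)
        fun i hi => ⟨?_, ?_, ?_⟩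
      · exact (hmid _ (by omega) (by omega)).2 (not_gap_lo _ _ _ (by omega))
      · exact (hhigh _ (by omega)).2 (Or.inr (Or.inr hg))
      · omega
  · refine rep_of r m (fun i => 3 * n + (2 * i + 1) * (8 * r) + 8 * r) (fun i hi j hj h => ?_)
      fun i hi => ?_
    · skip
      exact hinj i j (by omega)
    · have h1 := hs2 i
      have h2 := hq i hi
      refine ⟨?_, ?_, ?_⟩
      · exact (hmid _ (by omega) (by omega)).2
          (not_gap_block r n (i + 1) _ (by omega) (by omega))
      · have e : m - (3 * n + (2 * i + 1) * (8 * r) + 8 * r)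
            = n' - (3 * n + (2 * i + 1) * (8 * r) + 8 * r - (m - n')) := by omega
        rw [e, hhigh _ (by omega), hmid _ (by omega) (by omega)]
        exact Or.inl (not_not.2 (gap_block r n i _ (by omega) (by omega) (by omega)))
      · omega

lemma rep_diff (r m : ℕ) (S : Set ℕ) (hS : S.encard < (r : ℕ∞)) (h : rep r m) :
    m ∈ (bas r \ S) + (bas r \ S) := by
  classical
  obtain ⟨T, hT, hh⟩ := h
  by_contra hm
  have hfin : S.Finite := Set.finite_of_encard_le_coe hS.le
  have hlt : hfin.toFinset.card < T.card := by
    rw [hT]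
    rw [hfin.encard_eq_coe_toFinset_card] at hS
    exact_mod_cast hS
  have key : ∀ x ∈ T, (if x ∈ S then x else m - x) ∈ hfin.toFinset := by
    intro x hx
    obtain ⟨h1, h2, h3⟩ := hh x hx
    rw [Set.Finite.mem_toFinset]
    split_ifs with hxS
    · exact hxS
    · by_contra hyS
      exact hm ⟨x, ⟨h1, hxS⟩, m - x, ⟨h2, hyS⟩, by show x + (m - x) = m; omega⟩
  obtain ⟨x, hx, y, hy, hne, heq⟩ := Finset.exists_ne_map_eq_of_card_lt_of_maps_to hlt key
  have := (hh x hx).2.2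
  have := (hh y hy).2.2
  apply hne
  split_ifs at heq <;> omega

lemma enum_pair (j : ℕ) (F : Finset ℕ) : enum (Nat.pair j (Encodable.encode F)) = F := by
  simp [enum]

lemma bad_tgt (r k : ℕ) (S : Set ℕ) (hF : ∀ f ∈ enum k, f ∈ S) (hg : good r k (bas r)) :
    tgt r (k + 1) ∉ (bas r \ S) + (bas r \ S) := by
  have hodd := tgt_odd r (k + 1)
  have main : ∀ a b, a ∈ bas r → a ∉ S → b ∈ bas r → a + b = tgt r (k + 1) →
      2 * a < tgt r (k + 1) → False := by
    intro a b ha haS hb hab hlt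
    have e : b = tgt r (k + 1) - a := by omega
    rw [e, high_mem r k a hlt] at hb
    rcases hb with h | h | h
    · exact h ha
    · exact haS (hF a h)
    · exact h hg
  rintro ⟨a, ⟨ha, haS⟩, b, ⟨hb, hbS⟩, hab⟩
  replace hab : a + b = tgt r (k + 1) := hab
  rcases lt_or_ge (2 * a) (tgt r (k + 1)) with h | h
  · exact main a b ha haS hb hab h
  · exact main b a hb hbS ha (by omega) (by omega)

end RMin

/-- Erdős–Nathanson: for every `r ≥ 1` there exists an `r`-minimal asymptotic basis of
order 2 for `ℕ₀`: a set `A` such that `A \ S` is an asymptotic basis of order 2 if and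
only if `|S| < r`. -/
theorem stmt16 (r : ℕ) (hr : 1 ≤ r) :
    ∃ A : Set ℕ, ∀ S ⊆ A,
      ({n : ℕ | n ∉ (A \ S) + (A \ S)}.Finite ↔ S.encard < (r : ℕ∞)) := by
  refine ⟨RMin.bas r, fun S hS => ⟨fun hfin => ?_, fun hlt => ?_⟩⟩
  · by_contra hge
    rw [not_lt] at hge
    obtain ⟨F', hF'S, hF'c⟩ := Set.exists_subset_encard_eq hge
    have hF'fin : F'.Finite := Set.finite_of_encard_le_coe hF'c.le
    obtain ⟨F, rfl⟩ := hF'fin.exists_finset_coe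
    rw [Set.encard_coe_eq_coe_finsetCard] at hF'c
    have hFc : F.card = r := by exact_mod_cast hF'c
    obtain ⟨M, hM⟩ := hfin.bddAbove
    set k := Nat.pair (M + F.sup id) (Encodable.encode F) with hk
    have hkM : M + F.sup id ≤ k := Nat.left_le_pair _ _
    have hek : RMin.enum k = F := RMin.enum_pair _ _
    have h1 := RMin.lt_tgt r k
    have h2 := RMin.lt_tgt r (k + 1)
    have := hM (RMin.bad_tgt r k S (by rw [hek]; exact fun f hf => hF'S hf)
      ⟨by rw [hek]; exact hFc, by
        rw [hek]
        intro f hf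
        have : f ≤ F.sup id := Finset.le_sup (f := id) hf
        exact ⟨hS (hF'S hf), by omega⟩⟩)
    omega
  · refine (Set.finite_Iic (RMin.tgt r 0 + 8 * r)).subset fun m hm => ?_
    by_contra hlt'
    exact hm (RMin.rep_diff r m S hlt (RMin.rep_all r hr m (by simpa using hlt')))
end

section
/- There exists a partition of the nonnegative integers into two disjoint sets A and B (A ∪ B = ℕ₀, A ∩ B = ∅) such that: A is a minimal asymptotic basis of order 2 (ℕ₀ \ (A+A) is finite, and ℕ₀ \ ((A\{a})+(A\{a})) is infinite for every a ∈ A), and B is a maximal asymptotic nonbasis of order 2 (ℕ₀ \ (B+B) is infinite, and for every b* ∈ ℕ₀ \ B the set ℕ₀ \ ((B∪{b*})+(B∪{b*})) is finite). -/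
open Pointwise

namespace EN

/-- Stage boundaries. -/
def N : ℕ → ℕ
  | 0 => 100
  | k + 1 => 40 * N k + 1

/-- Periodic filler pattern: residues 0,1,3,4 mod 8. -/
def R (x : ℕ) : Bool := x % 8 == 0 || x % 8 == 1 || x % 8 == 3 || x % 8 == 4

/-- Stage of `x`. -/
def K (x : ℕ) : ℕ := Nat.findGreatest (fun k => N k ≤ x) x

/-- The parameter of stage `k`. -/
def p (k : ℕ) : ℕ := (Nat.unpair k).1

/-- The characteristic function of the set `A`. -/
def F (x : ℕ) : Bool :=
  if x < 100 then false
  else if x < 10 * N (K x) then R x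
  else if x < 20 * N (K x) then R (x + 7)
  else if x = 20 * N (K x) then (if _h : p (K x) < x then !(F (p (K x))) else false)
  else if _h : 40 * N (K x) - x < x then
    (!(F (40 * N (K x) - x)) || (40 * N (K x) - x == p (K x)))
  else false
termination_by x

lemma N_ge (k : ℕ) : 100 + k ≤ N k := by
  induction k with
  | zero => simp [N]
  | succ k ih => simp only [N]; omega

lemma N_mono : StrictMono N := strictMono_nat_of_lt_succ (fun k => by simp only [N]; omega)

lemma p_le (k : ℕ) : p k ≤ k := Nat.unpair_left_le k

lemma K_eq {k x : ℕ} (h1 : N k ≤ x) (h2 : x < N (k + 1)) : K x = k := by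
  unfold K
  rw [Nat.findGreatest_eq_iff]
  refine ⟨?_, fun _ => h1, fun n hn _ h => ?_⟩
  · have := N_ge k; omega
  · have := N_mono.monotone (show k + 1 ≤ n from hn); omega

lemma exists_stage (c m : ℕ) (h : 2 * 100 + c ≤ m) :
    ∃ k, 2 * N k + c ≤ m ∧ m < 2 * N (k + 1) + c := by
  have hex : ∃ k, m < 2 * N k + c := ⟨m, by have := N_ge m; omega⟩
  classical
  have h0 : Nat.find hex ≠ 0 := by
    intro h0
    have := Nat.find_spec hex
    rw [h0] at this; simp only [N] at this; omega
  obtain ⟨k, hk⟩ := Nat.exists_eq_succ_of_ne_zero h0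
  refine ⟨k, ?_, ?_⟩
  · have := Nat.find_min hex (m := k) (by omega); omega
  · have := Nat.find_spec hex
    rw [hk] at this; exact this

lemma F1 {k x : ℕ} (h1 : N k ≤ x) (h2 : x < 10 * N k) : F x = R x := by
  have := N_ge k
  have hK : K x = k := K_eq h1 (by simp only [N]; omega)
  rw [F, hK, if_neg (by omega), if_pos h2]

lemma F2 {k x : ℕ} (h1 : 10 * N k ≤ x) (h2 : x < 20 * N k) : F x = R (x + 7) := by
  have := N_ge k
  have hK : K x = k := K_eq (by omega) (by simp only [N]; omega)
  rw [F, hK, if_neg (by omega), if_neg (by omega), if_pos h2]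

lemma F3 (k : ℕ) : F (20 * N k) = !(F (p k)) := by
  have := N_ge k
  have := p_le k
  have hK : K (20 * N k) = k := K_eq (by omega) (by simp only [N]; omega)
  rw [F, hK, if_neg (by omega), if_neg (by omega), if_neg (by omega), if_pos rfl,
    dif_pos (by omega)]

lemma F4 {k y : ℕ} (h : y < 20 * N k) : F (40 * N k - y) = (!(F y) || (y == p k)) := by
  have := N_ge k
  have hK : K (40 * N k - y) = k := K_eq (by omega) (by simp only [N]; omega)
  have e : 40 * N k - (40 * N k - y) = y := by omega
  rw [F, hK, e, if_neg (by omega), if_neg (by omega), if_neg (by omega), if_neg (by omega),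
    dif_pos (by omega)]

lemma R_mod (x : ℕ) : R (x % 8) = R x := by simp [R]

lemma sum_base : ∀ v : Bool, ∀ a < 8, ∀ b < 8, ∃ j < 8,
    R (a + j) = v ∧ R (b + (7 - j)) = v := by decide

lemma R_sum (v : Bool) (i j u m : ℕ) (h : u + 7 ≤ m) :
    ∃ x, u ≤ x ∧ x ≤ u + 7 ∧ R (x + i) = v ∧ R (m - x + j) = v := by
  obtain ⟨l, hl, h1, h2⟩ := sum_base v ((u + i) % 8) (by omega) ((m - u - 7 + j) % 8) (by omega)
  refine ⟨u + l, by omega, by omega, ?_, ?_⟩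
  · rw [← h1, ← R_mod, ← R_mod ((u + i) % 8 + l)]; congr 1; omega
  · rw [← h2, ← R_mod, ← R_mod (_ + (7 - l))]; congr 1; omega

lemma diff_base : ∀ v : Bool, ∀ a < 8, ∀ e < 8, e ≠ 0 → ∃ j < 8,
    R (a + j) = v ∧ R (a + j + e) = !v := by decide

lemma R_diff (v : Bool) (u e : ℕ) (h : e % 8 ≠ 0) :
    ∃ x, u ≤ x ∧ x ≤ u + 7 ∧ R x = v ∧ R (x + e) = !v := by
  obtain ⟨l, hl, h1, h2⟩ := diff_base v (u % 8) (by omega) (e % 8) (by omega) h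
  refine ⟨u + l, by omega, by omega, ?_, ?_⟩
  · rw [← h1, ← R_mod, ← R_mod (u % 8 + l)]; congr 1; omega
  · rw [← h2, ← R_mod, ← R_mod (_ + e % 8)]; congr 1; omega

lemma F_diff (v : Bool) (k d : ℕ) (h1 : 1 ≤ d) (h2 : d ≤ 2 * N k) :
    ∃ x, N k ≤ x ∧ x + d < 20 * N k ∧ F x = v ∧ F (x + d) = !v := by
  have := N_ge k
  by_cases hd : d % 8 = 0
  · obtain ⟨x, a, b, c, e⟩ := R_diff v (10 * N k - 8) (d + 7) (by omega)
    refine ⟨x, by omega, by omega, ?_, ?_⟩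
    · rw [F1 (k := k) (by omega) (by omega), c]
    · rw [F2 (k := k) (by omega) (by omega), ← e]; congr 1
  · obtain ⟨x, a, b, c, e⟩ := R_diff v (N k) d hd
    refine ⟨x, by omega, by omega, ?_, ?_⟩
    · rw [F1 (k := k) (by omega) (by omega), c]
    · rw [F1 (k := k) (by omega) (by omega), e]

lemma cover (v : Bool) (m : ℕ) (hm : 216 ≤ m) :
    (∃ k, m = 40 * N k) ∨ ∃ x y, x + y = m ∧ F x = v ∧ F y = v := by
  obtain ⟨k, hk1, hk2⟩ := exists_stage 16 m (by omega)
  have hN := N_ge k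
  have hN' : N (k + 1) = 40 * N k + 1 := rfl
  by_cases hs : m = 40 * N k
  · exact Or.inl ⟨k, hs⟩
  right
  have f11 : ∀ u, N k ≤ u → u + 7 < 10 * N k → N k + u + 7 ≤ m → m < 10 * N k + u →
      ∃ x y, x + y = m ∧ F x = v ∧ F y = v := by
    intro u a b c d
    obtain ⟨x, h1, h2, h3, h4⟩ := R_sum v 0 0 u m (by omega)
    exact ⟨x, m - x, by omega, by rw [F1 (k := k) (by omega) (by omega)]; exact h3,
      by rw [F1 (k := k) (by omega) (by omega)]; exact h4⟩
  have f12 : ∀ u, N k ≤ u → u + 7 < 10 * N k → 10 * N k + u + 7 ≤ m → m < 20 * N k + u →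
      ∃ x y, x + y = m ∧ F x = v ∧ F y = v := by
    intro u a b c d
    obtain ⟨x, h1, h2, h3, h4⟩ := R_sum v 0 7 u m (by omega)
    exact ⟨x, m - x, by omega, by rw [F1 (k := k) (by omega) (by omega)]; exact h3,
      by rw [F2 (k := k) (by omega) (by omega)]; exact h4⟩
  have f22 : ∀ u, 10 * N k ≤ u → u + 7 < 20 * N k → 10 * N k + u + 7 ≤ m → m < 20 * N k + u →
      ∃ x y, x + y = m ∧ F x = v ∧ F y = v := by
    intro u a b c d
    obtain ⟨x, h1, h2, h3, h4⟩ := R_sum v 7 7 u m (by omega)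
    exact ⟨x, m - x, by omega, by rw [F2 (k := k) (by omega) (by omega)]; exact h3,
      by rw [F2 (k := k) (by omega) (by omega)]; exact h4⟩
  have hp := p_le k
  -- reflection
  have refl : ∀ x y, N k ≤ y → y < 20 * N k → x + (40 * N k - y) = m → F x = v → F y = (!v) →
      ∃ x y, x + y = m ∧ F x = v ∧ F y = v := by
    intro x y a b c d e
    refine ⟨x, 40 * N k - y, c, d, ?_⟩
    have : (y == p k) = false := by simp; omega
    rw [F4 b, e, this]; simp
  rcases lt_or_ge m (11 * N k) with h | h
  · exact f11 (N k) (by omega) (by omega) (by omega) (by omega)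
  rcases lt_or_ge m (12 * N k) with h | h
  · exact f11 (2 * N k) (by omega) (by omega) (by omega) (by omega)
  rcases lt_or_ge m (21 * N k) with h | h
  · exact f12 (N k) (by omega) (by omega) (by omega) (by omega)
  rcases lt_or_ge m (29 * N k) with h | h
  · exact f12 (9 * N k) (by omega) (by omega) (by omega) (by omega)
  rcases lt_or_ge m (31 * N k) with h | h
  · exact f22 (11 * N k) (by omega) (by omega) (by omega) (by omega)
  rcases le_or_gt m (40 * N k - 16) with h | h
  · exact f22 (m - 20 * N k + 1) (by omega) (by omega) (by omega) (by omega)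
  rcases lt_or_ge m (40 * N k) with h | h
  · obtain ⟨x, a, b, c, d⟩ := F_diff v k (40 * N k - m) (by omega) (by omega)
    exact refl x (x + (40 * N k - m)) (by omega) (by omega) (by omega) c d
  rcases lt_or_ge m (41 * N k + 20) with h | h
  · obtain ⟨x, a, b, c, d⟩ := F_diff (!v) k (m - 40 * N k) (by omega) (by omega)
    exact refl (x + (m - 40 * N k)) x (by omega) (by omega) (by omega) (by simpa using d) c
  · obtain ⟨x, h1, h2, h3, h4⟩ := R_sum v 0 0 (N k) m (by omega)
    exact ⟨x, m - x, by omega, by rw [F1 (k := k) (by omega) (by omega)]; exact h3,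
      by rw [F1 (k := k + 1) (by omega) (by omega)]; exact h4⟩

/-- Stages with parameter `a` occur infinitely often. -/
lemma inf_stage (a : ℕ) (P : ℕ → Prop) (h : ∀ k, p k = a → P (40 * N k)) :
    {n : ℕ | P n}.Infinite := by
  have hinj : Function.Injective (fun j => 40 * N (Nat.pair a j)) := by
    intro i j hij
    have h1 : N (Nat.pair a i) = N (Nat.pair a j) := by
      simp only at hij; omega
    have h2 := N_mono.injective h1
    exact (Nat.pair_eq_pair.mp h2).2
  refine (Set.infinite_range_of_injective hinj).mono ?_
  rintro _ ⟨j, rfl⟩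
  exact h _ (by simp [p])

/-- At a stage centre, the pair structure. -/
lemma pair_stage {k x y : ℕ} (h : x + y = 40 * N k) :
    (x = 20 * N k ∧ y = 20 * N k) ∨
    (x < 20 * N k ∧ F y = (!(F x) || (x == p k))) ∨
    (y < 20 * N k ∧ F x = (!(F y) || (y == p k))) := by
  rcases lt_trichotomy x (20 * N k) with hx | hx | hx
  · right; left
    exact ⟨hx, by rw [← F4 hx]; congr 1; omega⟩
  · left; omega
  · right; right
    have hy : y < 20 * N k := by omega
    exact ⟨hy, by rw [← F4 hy]; congr 1; omega⟩

end EN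

open EN in
/-- Erdős–Nathanson: there is a partition of `ℕ₀` into a minimal asymptotic basis `A` of
order 2 and a maximal asymptotic nonbasis `B` of order 2. -/
theorem stmt17 :
    ∃ A B : Set ℕ, A ∪ B = Set.univ ∧ A ∩ B = ∅ ∧
      ({n : ℕ | n ∉ A + A}.Finite ∧
        ∀ a ∈ A, {n : ℕ | n ∉ (A \ {a}) + (A \ {a})}.Infinite) ∧
      ({n : ℕ | n ∉ B + B}.Infinite ∧
        ∀ b ∉ B, {n : ℕ | n ∉ (B ∪ {b}) + (B ∪ {b})}.Finite) := by
  refine ⟨{x | F x = true}, {x | F x = false}, ?_, ?_, ⟨?_, ?_⟩, ?_, ?_⟩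
  · ext x; simp
  · ext x; simp
  · refine (Set.finite_lt_nat 216).subset ?_
    intro m hm
    by_contra hlt
    simp only [Set.mem_setOf_eq, not_lt] at hlt
    apply hm
    rcases cover true m hlt with ⟨k, rfl⟩ | ⟨x, y, h1, h2, h3⟩
    · cases hpk : F (p k) with
      | false =>
        have := F3 k
        rw [hpk] at this
        exact Set.mem_add.mpr ⟨_, this, _, this, by omega⟩
      | true =>
        have hp := p_le k
        have hN := N_ge k
        have := F4 (k := k) (y := p k) (by omega)
        refine Set.mem_add.mpr ⟨p k, hpk, 40 * N k - p k, ?_, by omega⟩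
        simp [this]
    · exact Set.mem_add.mpr ⟨x, h2, y, h3, h1⟩
  · intro a ha
    refine inf_stage a _ ?_
    intro k hk hmem
    obtain ⟨x, ⟨hx, hxa⟩, y, ⟨hy, hya⟩, hxy⟩ := Set.mem_add.mp hmem
    simp only [Set.mem_setOf_eq, Set.mem_singleton_iff] at ha hx hy hxa hya
    rcases pair_stage hxy with ⟨h1, h2⟩ | ⟨h1, h2⟩ | ⟨h1, h2⟩
    · have := F3 k
      rw [← h1, hk, hx, ha] at this
      simp at this
    · rw [hx, hy, hk] at h2
      simp at h2; exact hxa h2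
    · rw [hx, hy, hk] at h2
      simp at h2; exact hya h2
  · have h0 : F 0 = false := by rw [F]; simp
    refine inf_stage 0 _ ?_
    intro k hk hmem
    obtain ⟨x, hx, y, hy, hxy⟩ := Set.mem_add.mp hmem
    simp only [Set.mem_setOf_eq] at hx hy
    rcases pair_stage hxy with ⟨h1, h2⟩ | ⟨h1, h2⟩ | ⟨h1, h2⟩
    · have := F3 k
      rw [← h1, hk, hx, h0] at this
      simp at this
    · rw [hx, hy] at h2; simp at h2
    · rw [hx, hy] at h2; simp at h2
  · intro b hb
    have hb' : F b = true := by simpa using hb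
    refine (Set.finite_lt_nat (216 + 40 * N b)).subset ?_
    intro m hm
    by_contra hlt
    simp only [Set.mem_setOf_eq, not_lt] at hlt
    apply hm
    rcases cover false m (by omega) with ⟨k, rfl⟩ | ⟨x, y, h1, h2, h3⟩
    · cases hpk : F (p k) with
      | true =>
        have := F3 k
        rw [hpk] at this
        exact Set.mem_add.mpr ⟨_, Or.inl this, _, Or.inl this, by omega⟩
      | false =>
        have hN := N_ge b
        have hlt' : b < 20 * N k := by omega
        have := F4 (k := k) (y := b) hlt'
        have hne : (b == p k) = false := by
          simp only [beq_eq_false_iff_ne, ne_eq]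
          rintro rfl
          rw [hb'] at hpk; cases hpk
        rw [hb', hne] at this
        exact Set.mem_add.mpr ⟨b, Or.inr rfl, 40 * N k - b, Or.inl this, by omega⟩
    · exact Set.mem_add.mpr ⟨x, Or.inl h2, y, Or.inl h3, h1⟩
end
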